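/- arXiv:2004.04766 — 2 statements merged into one kernel-verified Lean document; each statement's English description precedes it below -/
import Mathlib

section
/- Suppose ε_x = o(1), k ≥ 1, and k·log(1/ε_x) = o(log₂ x) as x → ∞. Then the number of integers n ≤ x with exactly k distinct prime factors and largest prime factor at most x^{1−ε_x} is o(π_k(x)). -/
open Finset Real Filter Asymptotics

/-- `π_k(x) := #{n ≤ x : ω(n) = k}`. -/
noncomputable def pik (k : ℕ) (x : ℝ) : ℕ :=
  ((Finset.Icc 1 ⌊x⌋₊).filter (fun n => n.primeFactors.card = k)).card

/-- `π_k(x,y) := #{n ≤ x : ω(n) = k, P⁺(n) ≤ y}`. -/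
noncomputable def piky (k : ℕ) (x y : ℝ) : ℕ :=
  ((Finset.Icc 1 ⌊x⌋₊).filter
    (fun n => n.primeFactors.card = k ∧ ∀ p ∈ n.primeFactors, ((p : ℕ) : ℝ) ≤ y)).card


theorem sum_le_sum_of_injOn_of_le {ι κ : Type*} {s : Finset ι} {t : Finset κ} (e : ι → κ)
    {f : ι → ℝ} {g : κ → ℝ} (hmaps : ∀ i ∈ s, e i ∈ t) (hinj : Set.InjOn e s)
    (hfg : ∀ i ∈ s, f i ≤ g (e i)) (hg : ∀ b ∈ t, 0 ≤ g b) :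
    ∑ i ∈ s, f i ≤ ∑ b ∈ t, g b := by
  classical
  calc ∑ i ∈ s, f i ≤ ∑ i ∈ s, g (e i) := sum_le_sum hfg
    _ = ∑ b ∈ s.image e, g b := (sum_image hinj).symm
    _ ≤ ∑ b ∈ t, g b := sum_le_sum_of_subset_of_nonneg (image_subset_iff.2 hmaps)
        fun b hb _ => hg b hb

/-- The weight equal to `log q` on prime powers `q` and to zero elsewhere. -/
noncomputable def primePowLog (q : ℕ) : ℝ := if IsPrimePow q then Real.log q else 0

/-- The integers `1 ≤ m ≤ y` with exactly `j` distinct prime factors. -/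
noncomputable def omegaLevel (j : ℕ) (y : ℝ) : Finset ℕ :=
  (Finset.Icc 1 ⌊y⌋₊).filter (fun m => m.primeFactors.card = j)

/-- The sum of the reciprocals of the integers `1 ≤ m ≤ y` with `j` distinct prime factors. -/
noncomputable def recipSum (j : ℕ) (y : ℝ) : ℝ := ∑ m ∈ omegaLevel j y, (1 / m : ℝ)

theorem mem_omegaLevel {j m : ℕ} {y : ℝ} :
    m ∈ omegaLevel j y ↔ 1 ≤ m ∧ (m : ℝ) ≤ y ∧ m.primeFactors.card = j := by
  simp only [omegaLevel, Finset.mem_filter, Finset.mem_Icc, and_assoc]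
  refine and_congr_right fun h => ?_
  rw [Nat.le_floor_iff' (by omega)]

theorem primePowLog_nonneg (q : ℕ) : 0 ≤ primePowLog q := by
  unfold primePowLog
  split_ifs
  · exact Real.log_natCast_nonneg q
  · exact le_rfl

theorem primePowLog_of_prime {p : ℕ} (hp : p.Prime) : primePowLog p = Real.log p :=
  if_pos hp.isPrimePow

theorem primePowLog_mul_log_two_le (q : ℕ) :
    primePowLog q * Real.log 2 ≤ Real.log q * ArithmeticFunction.vonMangoldt q := by
  unfold primePowLog
  split_ifs with h
  · rw [ArithmeticFunction.vonMangoldt_apply, if_pos h]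
    have : (2 : ℝ) ≤ q.minFac := by
      exact_mod_cast (Nat.minFac_prime h.ne_one).two_le
    gcongr
  · simpa using mul_nonneg (Real.log_natCast_nonneg q) ArithmeticFunction.vonMangoldt_nonneg

theorem sum_primePowLog_not_prime_le {y : ℝ} (hy : 1 ≤ y) :
    ∑ q ∈ Finset.Icc 1 ⌊y⌋₊ with ¬ q.Prime, primePowLog q ≤ 3 * √y * Real.log y ^ 2 := by
  have hlog : 0 ≤ Real.log y := Real.log_nonneg hy
  have h1 : (∑ q ∈ Finset.Icc 1 ⌊y⌋₊ with ¬ q.Prime, primePowLog q) * Real.log 2 ≤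
      Real.log y * (2 * √y * Real.log y) := by
    calc _ = ∑ q ∈ Finset.Icc 1 ⌊y⌋₊ with ¬ q.Prime, primePowLog q * Real.log 2 := by
          rw [Finset.sum_mul]
      _ ≤ ∑ q ∈ Finset.Icc 1 ⌊y⌋₊ with ¬ q.Prime,
            Real.log y * ArithmeticFunction.vonMangoldt q := by
          refine sum_le_sum fun q hq => (primePowLog_mul_log_two_le q).trans ?_
          simp only [Finset.mem_filter, Finset.mem_Icc] at hq
          have : (q : ℝ) ≤ y := (Nat.le_floor_iff' (by omega)).1 hq.1.2
          have : (0 : ℝ) < q := by exact_mod_cast hq.1.1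
          gcongr
      _ = Real.log y * (Chebyshev.psi y - Chebyshev.theta y) := by
          rw [Chebyshev.psi_sub_theta_eq_sum_not_prime, Finset.mul_sum]
          rfl
      _ ≤ _ := by
          gcongr
          exact Chebyshev.psi_sub_theta_le hy
  have h2 := Real.log_two_gt_d9
  have h3 : 0 ≤ √y * Real.log y ^ 2 := by positivity
  by_contra! h
  nlinarith

theorem log_sq_le_mul_sqrt {y : ℝ} (hy : 1 ≤ y) : Real.log y ^ 2 ≤ 16 * √y := by
  have hy0 : 0 < y := by linarith
  set t := y ^ (1 / 4 : ℝ) with ht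
  have h1 : Real.log y ≤ 4 * t := by
    have := Real.log_le_self (Real.rpow_nonneg hy0.le (1 / 4 : ℝ))
    rw [Real.log_rpow hy0] at this
    linarith
  have h2 : t ^ 2 = √y := by
    rw [ht, Real.sqrt_eq_rpow, ← Real.rpow_natCast, ← Real.rpow_mul hy0.le]
    norm_num
  have h3 := Real.log_nonneg hy
  nlinarith

theorem sum_primePowLog_le {y : ℝ} (hy : 0 ≤ y) :
    ∑ q ∈ Finset.Icc 1 ⌊y⌋₊, primePowLog q ≤ 50 * y := by
  rcases lt_or_ge y 1 with h | h
  · rw [Nat.floor_eq_zero.2 h]; simp; linarith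
  rw [← Finset.sum_filter_add_sum_filter_not _ (fun q : ℕ => q.Prime)]
  have h1 := sum_primePowLog_not_prime_le h
  have h2 : ∑ q ∈ Finset.Icc 1 ⌊y⌋₊ with q.Prime, primePowLog q = Chebyshev.theta y :=
    sum_congr rfl fun q hq => primePowLog_of_prime (Finset.mem_filter.1 hq).2
  have h3 := Chebyshev.theta_le_log4_mul_x hy
  have h4 : Real.log 4 ≤ 2 := by
    rw [show (4 : ℝ) = 2 ^ 2 by norm_num, Real.log_pow]
    have := Real.log_two_lt_d9
    push_cast; linarith
  have h5 : 3 * √y * Real.log y ^ 2 ≤ 48 * y := by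
    have := Real.mul_self_sqrt hy
    nlinarith [log_sq_le_mul_sqrt h, Real.sqrt_nonneg y]
  nlinarith

theorem sum_div_eq_partial_summation (a : ℕ → ℝ) (N : ℕ) :
    ∑ q ∈ Finset.Icc 1 N, a q / q = (∑ q ∈ Finset.Icc 1 N, a q) / (N + 1) +
      ∑ n ∈ Finset.Icc 1 N, (∑ q ∈ Finset.Icc 1 n, a q) / (n * (n + 1)) := by
  induction N with
  | zero => simp
  | succ N ih =>
    rw [Finset.sum_Icc_succ_top (by omega), ih,
      Finset.sum_Icc_succ_top (by omega) (fun n : ℕ => _ / ((n : ℝ) * (n + 1))),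
      Finset.sum_Icc_succ_top (by omega) a]
    have : (N : ℝ) + 1 ≠ 0 := by positivity
    have : (N : ℝ) + 1 + 1 ≠ 0 := by positivity
    push_cast
    field_simp
    ring

theorem sum_primePowLog_div_le {y : ℝ} (hy : 2 ≤ y) :
    ∑ q ∈ Finset.Icc 1 ⌊y⌋₊, primePowLog q / q ≤ 200 * Real.log y := by
  have hA (n : ℕ) : ∑ q ∈ Finset.Icc 1 n, primePowLog q ≤ 50 * n := by
    simpa using sum_primePowLog_le (Nat.cast_nonneg (α := ℝ) n)
  rw [sum_div_eq_partial_summation]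
  have h1 : (∑ q ∈ Finset.Icc 1 ⌊y⌋₊, primePowLog q) / (⌊y⌋₊ + 1) ≤ 50 := by
    rw [div_le_iff₀ (by positivity)]
    linarith [hA ⌊y⌋₊]
  have h2 : ∑ n ∈ Finset.Icc 1 ⌊y⌋₊, (∑ q ∈ Finset.Icc 1 n, primePowLog q) / (n * (n + 1)) ≤
      50 * (harmonic ⌊y⌋₊ : ℝ) := by
    rw [harmonic_eq_sum_Icc]
    push_cast
    rw [Finset.mul_sum]
    refine sum_le_sum fun n hn => ?_
    have hn0 : (0 : ℝ) < n := by exact_mod_cast (Finset.mem_Icc.1 hn).1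
    rw [div_le_iff₀ (by positivity)]
    have := hA n
    field_simp
    nlinarith
  have h3 := harmonic_floor_le_one_add_log y (by linarith)
  have h4 : Real.log 2 ≤ Real.log y := Real.log_le_log (by norm_num) hy
  have := Real.log_two_gt_d9
  linarith

theorem primeFactors_ordCompl_eq_erase (n p : ℕ) :
    (n / p ^ n.factorization p).primeFactors = n.primeFactors.erase p := by
  rw [← Nat.support_factorization, Nat.factorization_ordCompl, Finsupp.support_erase,
    Nat.support_factorization]

theorem log_eq_sum_factorization {n : ℕ} (hn : n ≠ 0) :
    Real.log n = ∑ p ∈ n.primeFactors, Real.log ((p ^ n.factorization p : ℕ) : ℝ) := by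
  conv_lhs => rw [← Nat.prod_factorization_pow_eq_self hn]
  rw [Finsupp.prod, Nat.cast_prod, Real.log_prod]
  · simp
  · intro p hp
    have := (Nat.prime_of_mem_primeFactors hp).pos
    positivity

/-- Removing one maximal prime power from each integer with `j + 1` prime factors. -/
theorem sum_log_mul_le (j : ℕ) (x : ℝ) (g : ℕ → ℝ) (hg : ∀ n, 0 ≤ g n) :
    ∑ n ∈ omegaLevel (j + 1) x, Real.log n * g n ≤
      ∑ m ∈ omegaLevel j x, ∑ q ∈ Finset.Icc 1 ⌊x / m⌋₊, primePowLog q * g (q * m) := by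
  have h1 : ∑ n ∈ omegaLevel (j + 1) x, Real.log n * g n =
      ∑ a ∈ (omegaLevel (j + 1) x).sigma fun n => n.primeFactors,
        Real.log ((a.2 ^ a.1.factorization a.2 : ℕ) : ℝ) * g a.1 := by
    rw [Finset.sum_sigma]
    refine sum_congr rfl fun n hn => ?_
    rw [mem_omegaLevel] at hn
    simp only [← Finset.sum_mul]
    rw [← log_eq_sum_factorization (by omega)]
  have h2 : ∑ m ∈ omegaLevel j x, ∑ q ∈ Finset.Icc 1 ⌊x / m⌋₊, primePowLog q * g (q * m) =
      ∑ b ∈ (omegaLevel j x).sigma fun m => Finset.Icc 1 ⌊x / m⌋₊,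
        primePowLog b.2 * g (b.2 * b.1) := by
    rw [Finset.sum_sigma]
  rw [h1, h2]
  refine sum_le_sum_of_injOn_of_le
    (fun a => ⟨a.1 / a.2 ^ a.1.factorization a.2, a.2 ^ a.1.factorization a.2⟩) ?_ ?_ ?_ ?_
  · rintro ⟨n, p⟩ h
    simp only [Finset.mem_sigma, mem_omegaLevel, Finset.mem_Icc] at h ⊢
    obtain ⟨⟨hn1, hnx, hnc⟩, hp⟩ := h
    have hpp := Nat.prime_of_mem_primeFactors hp
    have hn0 : n ≠ 0 := by omega
    have hpos := Nat.ordCompl_pos p hn0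
    refine ⟨⟨hpos, ?_, ?_⟩, Nat.pos_of_ne_zero (pow_ne_zero _ hpp.ne_zero), ?_⟩
    · exact le_trans (by exact_mod_cast Nat.ordCompl_le n p) hnx
    · rw [primeFactors_ordCompl_eq_erase, Finset.card_erase_of_mem hp, hnc]
      rfl
    · apply Nat.le_floor
      rw [le_div_iff₀ (by exact_mod_cast hpos)]
      refine le_trans (le_of_eq ?_) hnx
      exact_mod_cast Nat.ordProj_mul_ordCompl_eq_self n p
  · rintro ⟨n, p⟩ h ⟨n', p'⟩ h' heq
    simp only [Finset.coe_sigma, Set.mem_sigma_iff, Finset.mem_coe, mem_omegaLevel] at h h'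
    simp only [Sigma.mk.injEq, heq_eq_eq] at heq
    have hn : n = n' := by
      rw [← Nat.ordProj_mul_ordCompl_eq_self n p, ← Nat.ordProj_mul_ordCompl_eq_self n' p',
        heq.1, heq.2]
    have hpp := Nat.prime_of_mem_primeFactors h.2
    have hpp' := Nat.prime_of_mem_primeFactors h'.2
    have hv : n.factorization p ≠ 0 :=
      (hpp.factorization_pos_of_dvd (by omega) (Nat.dvd_of_mem_primeFactors h.2)).ne'
    have hv' : n'.factorization p' ≠ 0 :=
      (hpp'.factorization_pos_of_dvd (by omega) (Nat.dvd_of_mem_primeFactors h'.2)).ne'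
    have hp : p = p' := by
      rw [← Nat.Prime.pow_minFac hpp hv, heq.2, Nat.Prime.pow_minFac hpp' hv']
    subst hn hp
    rfl
  · rintro ⟨n, p⟩ h
    simp only [Finset.mem_sigma, mem_omegaLevel] at h ⊢
    have hpp := Nat.prime_of_mem_primeFactors h.2
    have hv : n.factorization p ≠ 0 :=
      (hpp.factorization_pos_of_dvd (by omega) (Nat.dvd_of_mem_primeFactors h.2)).ne'
    rw [primePowLog, if_pos (hpp.isPrimePow.pow hv), Nat.ordProj_mul_ordCompl_eq_self]
  · exact fun b _ => mul_nonneg (primePowLog_nonneg _) (hg _)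

theorem omegaLevel_subset {j : ℕ} {y z : ℝ} (h : y ≤ z) : omegaLevel j y ⊆ omegaLevel j z := by
  intro m hm
  rw [mem_omegaLevel] at hm ⊢
  exact ⟨hm.1, hm.2.1.trans h, hm.2.2⟩

theorem recipSum_nonneg (j : ℕ) (y : ℝ) : 0 ≤ recipSum j y :=
  sum_nonneg fun _ _ => by positivity

theorem recipSum_mono (j : ℕ) : Monotone (recipSum j) := fun _ _ h =>
  sum_le_sum_of_subset_of_nonneg (omegaLevel_subset h) fun _ _ _ => by positivity

theorem recipSum_zero {y : ℝ} (hy : 1 ≤ y) : recipSum 0 y = 1 := by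
  have : omegaLevel 0 y = {1} := by
    ext m
    rw [mem_omegaLevel, Finset.mem_singleton, Finset.card_eq_zero, Nat.primeFactors_eq_empty]
    constructor
    · rintro ⟨h1, -, h2⟩
      omega
    · rintro rfl
      simpa using hy
  simp [recipSum, this]

theorem recipSum_sub_eq {j : ℕ} {y z : ℝ} (h : y ≤ z) :
    recipSum j z - recipSum j y = ∑ m ∈ (omegaLevel j z).filter (fun m : ℕ => y < (m : ℝ)), (1 / m : ℝ) := by
  have : omegaLevel j y = (omegaLevel j z).filter fun m : ℕ => ¬ y < (m : ℝ) := by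
    ext m
    simp only [Finset.mem_filter, mem_omegaLevel, not_lt]
    constructor
    · rintro ⟨h1, h2, h3⟩
      exact ⟨⟨h1, h2.trans h, h3⟩, h2⟩
    · rintro ⟨⟨h1, -, h3⟩, h2⟩
      exact ⟨h1, h2, h3⟩
  rw [recipSum, recipSum, this, ← Finset.sum_filter_add_sum_filter_not (omegaLevel j z)
    (fun m : ℕ => y < (m : ℝ))]
  ring

theorem recipSum_succ_sq_sub_le (j : ℕ) {y : ℝ} (hy : 2 ≤ y) :
    recipSum (j + 1) (y ^ 2) - recipSum (j + 1) y ≤ 400 * recipSum j (y ^ 2) := by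
  have hlog : 0 < Real.log y := Real.log_pos (by linarith)
  have hyy : y ≤ y ^ 2 := by nlinarith
  have h1 : Real.log y * (recipSum (j + 1) (y ^ 2) - recipSum (j + 1) y) ≤
      ∑ n ∈ omegaLevel (j + 1) (y ^ 2), Real.log n * (1 / n : ℝ) := by
    rw [recipSum_sub_eq hyy, Finset.mul_sum]
    calc _ ≤ ∑ m ∈ (omegaLevel (j + 1) (y ^ 2)).filter (fun m : ℕ => y < (m : ℝ)),
            Real.log m * (1 / m : ℝ) := by
          refine sum_le_sum fun m hm => ?_
          have := (Finset.mem_filter.1 hm).2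
          gcongr
      _ ≤ _ := sum_le_sum_of_subset_of_nonneg (Finset.filter_subset _ _) fun m _ _ =>
          mul_nonneg (Real.log_natCast_nonneg m) (by positivity)
  have h2 := sum_log_mul_le j (y ^ 2) (fun n => (1 / n : ℝ)) (fun n => by positivity)
  have h3 : ∑ m ∈ omegaLevel j (y ^ 2), ∑ q ∈ Finset.Icc 1 ⌊y ^ 2 / m⌋₊,
      primePowLog q * (1 / (q * m : ℕ) : ℝ) ≤
      ∑ m ∈ omegaLevel j (y ^ 2), (1 / m : ℝ) * (200 * Real.log (y ^ 2)) := by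
    refine sum_le_sum fun m hm => ?_
    rw [mem_omegaLevel] at hm
    have hm1 : (1 : ℝ) ≤ m := by exact_mod_cast hm.1
    calc _ = (1 / m : ℝ) * ∑ q ∈ Finset.Icc 1 ⌊y ^ 2 / m⌋₊, primePowLog q / q := by
          rw [Finset.mul_sum]
          refine sum_congr rfl fun q _ => ?_
          push_cast
          rw [one_div, mul_inv]
          ring
      _ ≤ (1 / m : ℝ) * ∑ q ∈ Finset.Icc 1 ⌊y ^ 2⌋₊, primePowLog q / q := by
          gcongr
          · intro q _ _
            exact div_nonneg (primePowLog_nonneg q) (by positivity)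
          · exact div_le_self (by positivity) hm1
      _ ≤ _ := by
          gcongr
          exact sum_primePowLog_div_le (by linarith)
  rw [← Finset.sum_mul, ← recipSum, Real.log_pow] at h3
  push_cast at h3
  have h4 := h1.trans (h2.trans (by push_cast; exact h3))
  refine le_of_mul_le_mul_left (h4.trans (le_of_eq ?_)) hlog
  ring

theorem recipSum_succ_sub_rpow_le (j i : ℕ) {x : ℝ} (hx : 1 ≤ x)
    (h : 2 ≤ x ^ ((1 / 2 : ℝ) ^ i)) :
    recipSum (j + 1) x - recipSum (j + 1) (x ^ ((1 / 2 : ℝ) ^ i)) ≤ 400 * i * recipSum j x := by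
  induction i with
  | zero => simp
  | succ i ih =>
    have hsq : (x ^ ((1 / 2 : ℝ) ^ (i + 1))) ^ 2 = x ^ ((1 / 2 : ℝ) ^ i) := by
      rw [← Real.rpow_natCast, ← Real.rpow_mul (by linarith)]
      congr 1
      rw [pow_succ]
      push_cast
      ring
    have h1 := recipSum_succ_sq_sub_le j h
    rw [hsq] at h1
    have h2 := ih (by rw [← hsq]; nlinarith)
    have h3 : recipSum j (x ^ ((1 / 2 : ℝ) ^ i)) ≤ recipSum j x := by
      apply recipSum_mono
      calc x ^ ((1 / 2 : ℝ) ^ i) ≤ x ^ (1 : ℝ) :=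
            Real.rpow_le_rpow_of_exponent_le hx (pow_le_one₀ (by norm_num) (by norm_num))
        _ = x := Real.rpow_one x
    push_cast
    linarith

theorem harmonic_le_two_mul_prod (N : ℕ) :
    ∑ n ∈ Finset.Icc 1 N, (1 / n : ℝ) ≤
      2 * ∏ p ∈ Finset.Icc 1 N with p.Prime, (1 + 1 / p : ℝ) := by
  classical
  choose a b hab ha using Nat.sq_mul_squarefree
  have hb2 : ∑ b ∈ Finset.Icc 1 N, (1 / (b : ℝ) ^ 2) ≤ 2 := by
    have := sum_Ioo_inv_sq_le (α := ℝ) 0 (N + 1)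
    have h : Finset.Ioo 0 (N + 1) = Finset.Icc 1 N := by ext; simp; omega
    rw [h] at this
    simpa [one_div] using this
  have h1 : ∑ n ∈ Finset.Icc 1 N, (1 / n : ℝ) ≤
      ∑ z ∈ Finset.Icc 1 N ×ˢ (Finset.filter Nat.Prime (Finset.Icc 1 N)).powerset,
        (1 / (z.1 : ℝ) ^ 2) * ∏ p ∈ z.2, (1 / p : ℝ) := by
    have hmul (n : ℕ) : n = b n ^ 2 * ∏ p ∈ (a n).primeFactors, p := by
      rw [Nat.prod_primeFactors_of_squarefree (ha n), hab]
    refine sum_le_sum_of_injOn_of_le (fun n => (b n, (a n).primeFactors)) ?_ ?_ ?_ ?_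
    · intro n hn
      rw [Finset.mem_Icc] at hn
      have hb : b n ∣ n := ⟨b n * a n, by rw [← mul_assoc, ← sq, hab]⟩
      have hadvd : a n ∣ n := ⟨b n ^ 2, by rw [mul_comm, hab]⟩
      simp only [Finset.mem_product, Finset.mem_powerset, Finset.mem_Icc]
      refine ⟨⟨Nat.pos_of_dvd_of_pos hb (by omega), (Nat.le_of_dvd (by omega) hb).trans hn.2⟩, ?_⟩
      intro p hp
      have hpp := Nat.prime_of_mem_primeFactors hp
      rw [Finset.mem_filter, Finset.mem_Icc]
      exact ⟨⟨hpp.pos, (Nat.le_of_dvd (by omega)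
        ((Nat.dvd_of_mem_primeFactors hp).trans hadvd)).trans hn.2⟩, hpp⟩
    · intro n _ n' _ h
      simp only [Prod.mk.injEq] at h
      rw [hmul n, hmul n', h.1, h.2]
    · intro n _
      apply le_of_eq
      conv_lhs => rw [hmul n]
      push_cast
      simp [mul_comm]
    · intro z _
      positivity
  refine h1.trans ?_
  rw [Finset.prod_one_add, Finset.sum_product' (f := fun (b : ℕ) (t : Finset ℕ) =>
    (1 / (b : ℝ) ^ 2) * ∏ p ∈ t, (1 / (p : ℝ))), ← Finset.sum_mul_sum]
  gcongr

theorem log_log_le_sum_prime_inv {y : ℝ} (hy : 2 ≤ y) :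
    Real.log (Real.log y) - Real.log 2 ≤ ∑ p ∈ Finset.Icc 1 ⌊y⌋₊ with p.Prime, (1 / p : ℝ) := by
  have hlog : 0 < Real.log y := Real.log_pos (by linarith)
  have h1 : Real.log y ≤ ∑ n ∈ Finset.Icc 1 ⌊y⌋₊, (1 / n : ℝ) := by
    have := log_le_harmonic_floor y (by linarith)
    rw [harmonic_eq_sum_Icc] at this
    push_cast at this
    simpa [one_div] using this
  have h2 := h1.trans (harmonic_le_two_mul_prod ⌊y⌋₊)
  have h3 := Real.prod_one_add_le_exp_sum (Finset.filter Nat.Prime (Finset.Icc 1 ⌊y⌋₊))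
    (f := fun p : ℕ => (1 / p : ℝ)) (fun p => by positivity)
  have h4 : Real.log y ≤ 2 * Real.exp (∑ p ∈ Finset.Icc 1 ⌊y⌋₊ with p.Prime, (1 / p : ℝ)) := by
    linarith
  have h5 := Real.log_le_log hlog h4
  rw [Real.log_mul (by norm_num) (Real.exp_ne_zero _), Real.log_exp] at h5
  linarith

theorem primeFactors_mul_prime {m p : ℕ} (hm : m ≠ 0) (hp : p.Prime) :
    (m * p).primeFactors = insert p m.primeFactors := by
  rw [Nat.primeFactors_mul hm hp.ne_zero, hp.primeFactors, Finset.union_comm]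
  rfl

theorem card_primeFactors_mul_prime {m p : ℕ} (hm : m ≠ 0) (hp : p.Prime) (h : ¬ p ∣ m) :
    (m * p).primeFactors.card = m.primeFactors.card + 1 := by
  rw [primeFactors_mul_prime hm hp, Finset.card_insert_of_notMem]
  exact fun h' => h (Nat.dvd_of_mem_primeFactors h')

theorem sum_primeFactors_inv_le (m : ℕ) :
    ∑ p ∈ m.primeFactors, (1 / p : ℝ) ≤ m.primeFactors.card / 2 := by
  calc _ ≤ ∑ p ∈ m.primeFactors, (1 / 2 : ℝ) := by
        refine sum_le_sum fun p hp => ?_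
        have : (2 : ℝ) ≤ p := by exact_mod_cast (Nat.prime_of_mem_primeFactors hp).two_le
        gcongr
    _ = _ := by rw [Finset.sum_const, nsmul_eq_mul]; ring

/-- Multiplying by a new prime: each integer with `j + 1` prime factors arises at most `j + 1`
times. -/
theorem recipSum_sqrt_mul_le (j : ℕ) {x : ℝ} (hx : 1 ≤ x) (hL : 4 ≤ Real.log (Real.log x))
    (hj : (j : ℝ) ≤ Real.log (Real.log x) / 2) :
    Real.log (Real.log x) / 4 * recipSum j (√x) ≤ (j + 1) * recipSum (j + 1) x := by
  have hlogpos : 0 < Real.log x := by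
    by_contra! h
    have := Real.log_nonneg hx
    rw [le_antisymm h this, Real.log_zero] at hL
    linarith
  have hx0 : 0 < x := by linarith
  have hsq : 2 ≤ √x := by
    apply Real.le_sqrt_of_sq_le
    have h1 := Real.log_le_self hlogpos.le
    have h2 := Real.log_le_self hx0.le
    linarith
  have hL2 := log_log_le_sum_prime_inv hsq
  rw [Real.log_sqrt hx0.le, Real.log_div hlogpos.ne' (by norm_num)] at hL2
  have hlog2 := Real.log_two_lt_d9
  set P := Finset.filter Nat.Prime (Finset.Icc 1 ⌊√x⌋₊) with hP
  have h1 : Real.log (Real.log x) / 4 * recipSum j (√x) ≤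
      ∑ a ∈ (omegaLevel j (√x)).sigma fun m => P \ m.primeFactors, (1 / (a.1 * a.2 : ℕ) : ℝ) := by
    rw [recipSum, Finset.sum_sigma, Finset.mul_sum]
    refine sum_le_sum fun m hm => ?_
    rw [mem_omegaLevel] at hm
    have h2 : ∑ p ∈ P, (1 / p : ℝ) ≤
        ∑ p ∈ P \ m.primeFactors, (1 / p : ℝ) + ∑ p ∈ m.primeFactors, (1 / p : ℝ) := by
      rw [← Finset.sum_union Finset.sdiff_disjoint]
      refine sum_le_sum_of_subset_of_nonneg ?_ fun _ _ _ => by positivity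
      intro p hp
      by_cases h : p ∈ m.primeFactors <;> simp_all
    have h3 := sum_primeFactors_inv_le m
    rw [hm.2.2] at h3
    calc _ ≤ (∑ p ∈ P \ m.primeFactors, (1 / p : ℝ)) * (1 / m : ℝ) := by
          gcongr
          linarith
      _ = _ := by
          rw [Finset.sum_mul]
          refine sum_congr rfl fun p _ => ?_
          push_cast
          rw [one_div, one_div, one_div, mul_inv, mul_comm]
  have h2 : ((j : ℝ) + 1) * recipSum (j + 1) x =
      ∑ b ∈ (omegaLevel (j + 1) x).sigma fun n => n.primeFactors, (1 / b.1 : ℝ) := by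
    rw [recipSum, Finset.sum_sigma, Finset.mul_sum]
    refine sum_congr rfl fun n hn => ?_
    simp only [Finset.sum_const, (mem_omegaLevel.1 hn).2.2, nsmul_eq_mul]
    push_cast
    rfl
  rw [h2]
  refine h1.trans (sum_le_sum_of_injOn_of_le (fun a => ⟨a.1 * a.2, a.2⟩) ?_ ?_ ?_ ?_)
  · rintro ⟨m, p⟩ h
    simp only [hP, Finset.mem_sigma, mem_omegaLevel, Finset.mem_sdiff, Finset.mem_filter,
      Finset.mem_Icc] at h ⊢
    obtain ⟨⟨hm1, hmx, hmc⟩, ⟨⟨hp1, hpx⟩, hpp⟩, hpm⟩ := h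
    have hm0 : m ≠ 0 := by omega
    have hpx' : (p : ℝ) ≤ √x := (Nat.le_floor_iff' (by omega)).1 hpx
    refine ⟨⟨Nat.mul_pos hm1 hp1, ?_, ?_⟩, ?_⟩
    · push_cast
      calc (m : ℝ) * p ≤ √x * √x := by gcongr
        _ = x := Real.mul_self_sqrt hx0.le
    · rw [card_primeFactors_mul_prime hm0 hpp, hmc]
      exact fun h => hpm (Nat.mem_primeFactors.2 ⟨hpp, h, hm0⟩)
    · rw [primeFactors_mul_prime hm0 hpp]
      exact Finset.mem_insert_self _ _
  · rintro ⟨m, p⟩ h ⟨m', p'⟩ h' heq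
    simp only [Sigma.mk.injEq, heq_eq_eq] at heq
    obtain ⟨h1, rfl⟩ := heq
    simp only [hP, Finset.mem_coe, Finset.mem_sigma, Finset.mem_sdiff, Finset.mem_filter] at h
    have := Nat.eq_of_mul_eq_mul_right h.2.1.2.pos h1
    subst this
    rfl
  · rintro ⟨m, p⟩ _
    exact le_rfl
  · intro b _
    positivity

theorem recipSum_le_succ (j : ℕ) {x : ℝ} (hx : 4 ≤ x) (hL : 4 ≤ Real.log (Real.log x))
    (hj : ((j : ℝ) + 1) ≤ Real.log (Real.log x) / 20000) :
    recipSum j x ≤ 8 * (j + 1) / Real.log (Real.log x) * recipSum (j + 1) x := by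
  have hsqrt : x ^ ((1 / 2 : ℝ) ^ 1) = √x := by rw [pow_one, Real.sqrt_eq_rpow]
  have hsq : 2 ≤ √x := Real.le_sqrt_of_sq_le (by linarith)
  have hmain (j : ℕ) (hj : ((j : ℝ) + 1) ≤ Real.log (Real.log x) / 20000)
      (h : recipSum j x ≤ 2 * recipSum j (√x)) :
      recipSum j x ≤ 8 * (j + 1) / Real.log (Real.log x) * recipSum (j + 1) x := by
    have h1 := recipSum_sqrt_mul_le j (by linarith) hL (by linarith)
    rw [div_mul_eq_mul_div, le_div_iff₀ (by linarith)]
    nlinarith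
  refine hmain j hj ?_
  induction j with
  | zero => rw [recipSum_zero (by linarith), recipSum_zero (by linarith)]; norm_num
  | succ j ih =>
    push_cast at hj
    have h0 := recipSum_succ_sub_rpow_le j 1 (x := x) (by linarith) (by rwa [hsqrt])
    rw [hsqrt] at h0
    have h1 := hmain j (by linarith) (ih (by linarith))
    have h2 : 8 * ((j : ℝ) + 1) / Real.log (Real.log x) ≤ 1 / 2500 := by
      rw [div_le_iff₀ (by linarith)]
      linarith
    have h3 := recipSum_nonneg (j + 1) x
    push_cast at h0
    nlinarith

theorem one_le_recipSum (j : ℕ) {x : ℝ} (hx : 4 ≤ x) (hL : 4 ≤ Real.log (Real.log x))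
    (hj : (j : ℝ) ≤ Real.log (Real.log x) / 20000) : 1 ≤ recipSum j x := by
  induction j with
  | zero => rw [recipSum_zero (by linarith)]
  | succ j ih =>
    push_cast at hj
    have h1 := ih (by linarith)
    have h2 := recipSum_le_succ j hx hL hj
    have h3 : 8 * ((j : ℝ) + 1) / Real.log (Real.log x) ≤ 1 := by
      rw [div_le_iff₀ (by linarith)]
      linarith
    nlinarith [recipSum_nonneg (j + 1) x]

theorem recipSum_sub_rpow_le (j i : ℕ) {x : ℝ} (hx : 4 ≤ x) (hL : 4 ≤ Real.log (Real.log x))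
    (hj : (j : ℝ) ≤ Real.log (Real.log x) / 20000) (h : 2 ≤ x ^ ((1 / 2 : ℝ) ^ i)) :
    recipSum j x - recipSum j (x ^ ((1 / 2 : ℝ) ^ i)) ≤
      3200 * i * j / Real.log (Real.log x) * recipSum j x := by
  cases j with
  | zero => rw [recipSum_zero (by linarith), recipSum_zero (by linarith)]; simp
  | succ j =>
    push_cast at hj
    have h1 := recipSum_succ_sub_rpow_le j i (by linarith) h
    have h2 := recipSum_le_succ j hx hL hj
    refine h1.trans ?_
    calc 400 * (i : ℝ) * recipSum j x
        ≤ 400 * i * (8 * (j + 1) / Real.log (Real.log x) * recipSum (j + 1) x) := by gcongr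
      _ = _ := by push_cast; ring

theorem eventually_half_le_theta : ∀ᶠ y : ℝ in atTop, y / 2 ≤ Chebyshev.theta y := by
  have h := (isLittleO_log_rpow_atTop (r := 1 / 2) (by norm_num)).bound
    (show (0 : ℝ) < 1 / 100 by norm_num)
  filter_upwards [h, eventually_ge_atTop 16] with y hy h16
  have hlog : 0 ≤ Real.log y := Real.log_nonneg (by linarith)
  rw [← Real.sqrt_eq_rpow, Real.norm_of_nonneg hlog, Real.norm_of_nonneg (Real.sqrt_nonneg y)] at hy
  have h1 := Chebyshev.theta_ge' (x := y) (by linarith)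
  have h2 : Real.log (y + 2) ≤ 2 * Real.log y := by
    rw [← Real.log_rpow (by linarith)]
    apply Real.log_le_log (by linarith)
    norm_num
    nlinarith
  have h3 := Real.mul_self_sqrt (show 0 ≤ y by linarith)
  have h4 : √y ≤ y := by
    rw [Real.sqrt_le_left (by linarith)]
    nlinarith
  have h5 := Real.log_two_gt_d9
  have h6 : 2 * √y * Real.log y ≤ y / 50 := by nlinarith [Real.sqrt_nonneg y]
  nlinarith

theorem theta_sub_theta_eq {y z : ℝ} (h : y ≤ z) :
    Chebyshev.theta z - Chebyshev.theta y =
      ∑ p ∈ Finset.Ioc ⌊y⌋₊ ⌊z⌋₊ with p.Prime, Real.log p := by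
  have h1 : Finset.Ioc 0 ⌊z⌋₊ = Finset.Ioc 0 ⌊y⌋₊ ∪ Finset.Ioc ⌊y⌋₊ ⌊z⌋₊ :=
    (Finset.Ioc_union_Ioc_eq_Ioc (Nat.zero_le _) (Nat.floor_mono h)).symm
  have h2 : Disjoint (Finset.Ioc 0 ⌊y⌋₊) (Finset.Ioc ⌊y⌋₊ ⌊z⌋₊) := by
    rw [Finset.disjoint_left]
    intro p hp
    simp only [Finset.mem_Ioc] at hp ⊢
    omega
  rw [Chebyshev.theta, Chebyshev.theta, h1, Finset.filter_union,
    Finset.sum_union (Finset.disjoint_filter_filter h2)]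
  ring

theorem sum_theta_sub_le (j : ℕ) {x : ℝ} (hx : 1 ≤ x) :
    ∑ m ∈ omegaLevel j (x ^ (1 / 4 : ℝ)), (Chebyshev.theta (x / m) - Chebyshev.theta (√x)) ≤
      Real.log x * pik (j + 1) x := by
  have hx0 : 0 < x := by linarith
  have hlog : 0 ≤ Real.log x := Real.log_nonneg hx
  have hquart : x ^ (1 / 4 : ℝ) ≤ √x := by
    rw [Real.sqrt_eq_rpow]
    exact Real.rpow_le_rpow_of_exponent_le hx (by norm_num)
  have hsq := Real.mul_self_sqrt hx0.le
  have hsq1 : 1 ≤ √x := Real.one_le_sqrt.2 hx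
  set T := (omegaLevel j (x ^ (1 / 4 : ℝ))).sigma fun m =>
    (Finset.Ioc ⌊√x⌋₊ ⌊x / m⌋₊).filter Nat.Prime with hT
  have h1 : ∑ m ∈ omegaLevel j (x ^ (1 / 4 : ℝ)),
      (Chebyshev.theta (x / m) - Chebyshev.theta (√x)) ≤ Real.log x * T.card := by
    rw [hT, Finset.card_sigma, Nat.cast_sum, Finset.mul_sum]
    refine sum_le_sum fun m hm => ?_
    rw [mem_omegaLevel] at hm
    have hm0 : (1 : ℝ) ≤ m := by exact_mod_cast hm.1
    rw [theta_sub_theta_eq]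
    · rw [mul_comm, ← nsmul_eq_mul]
      refine Finset.sum_le_card_nsmul _ _ _ fun p hp => ?_
      simp only [Finset.mem_filter, Finset.mem_Ioc] at hp
      have hpx : (p : ℝ) ≤ x / m := (Nat.le_floor_iff' hp.2.ne_zero).1 hp.1.2
      apply Real.log_le_log (by exact_mod_cast hp.2.pos)
      exact hpx.trans (div_le_self hx0.le hm0)
    · rw [le_div_iff₀ (by linarith)]
      calc √x * m ≤ √x * √x := by gcongr; linarith [hm.2.1]
        _ = x := hsq
  refine h1.trans ?_
  gcongr
  refine Finset.card_le_card_of_injOn (fun a => a.1 * a.2) ?_ ?_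
  · rintro ⟨m, p⟩ h
    simp only [hT, Finset.coe_sigma, Set.mem_sigma_iff, Finset.mem_coe, mem_omegaLevel,
      Finset.mem_filter, Finset.mem_Ioc] at h
    obtain ⟨⟨hm1, hmx, hmc⟩, ⟨hp1, hp2⟩, hpp⟩ := h
    have hm0 : (0 : ℝ) < m := by exact_mod_cast hm1
    have hpx : (p : ℝ) ≤ x / m := (Nat.le_floor_iff' hpp.ne_zero).1 hp2
    rw [le_div_iff₀ hm0] at hpx
    have hxp : √x < p := (Nat.floor_lt (by linarith)).1 hp1
    have hmp : m < p := by
      have : (m : ℝ) < p := by linarith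
      exact_mod_cast this
    change m * p ∈ omegaLevel (j + 1) x
    rw [mem_omegaLevel]
    refine ⟨Nat.mul_pos hm1 hpp.pos, ?_, ?_⟩
    · push_cast
      linarith
    · rw [card_primeFactors_mul_prime (by omega) hpp (Nat.not_dvd_of_pos_of_lt hm1 hmp), hmc]
  · rintro ⟨m, p⟩ h ⟨m', p'⟩ h' heq
    simp only [hT, Finset.coe_sigma, Set.mem_sigma_iff, Finset.mem_coe, mem_omegaLevel,
      Finset.mem_filter, Finset.mem_Ioc] at h h' heq
    obtain ⟨⟨hm1, hmx, -⟩, ⟨hp1, -⟩, hpp⟩ := h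
    obtain ⟨⟨hm1', hmx', -⟩, ⟨hp1', -⟩, hpp'⟩ := h'
    have hxp : √x < p := (Nat.floor_lt (by linarith)).1 hp1
    have hmp' : m' < p := by
      have : (m' : ℝ) < p := by linarith
      exact_mod_cast this
    have hdvd : p ∣ m' * p' := ⟨m, by rw [← heq, mul_comm]⟩
    have hpe : p = p' := by
      rcases hpp.dvd_mul.1 hdvd with h | h
      · exact absurd h (Nat.not_dvd_of_pos_of_lt hm1' hmp')
      · exact (Nat.prime_dvd_prime_iff_eq hpp hpp').1 h
    subst hpe
    have := Nat.eq_of_mul_eq_mul_right hpp.pos heq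
    subst this
    rfl

theorem eventually_le_pik : ∀ᶠ x : ℝ in atTop, ∀ j : ℕ,
    x / (4 * Real.log x) * recipSum j (x ^ (1 / 4 : ℝ)) ≤ pik (j + 1) x := by
  have h34 : Tendsto (fun x : ℝ => x ^ (3 / 4 : ℝ)) atTop atTop :=
    tendsto_rpow_atTop (by norm_num)
  have h14 : Tendsto (fun x : ℝ => x ^ (1 / 4 : ℝ)) atTop atTop :=
    tendsto_rpow_atTop (by norm_num)
  obtain ⟨Y, hY⟩ := eventually_atTop.1 eventually_half_le_theta
  filter_upwards [h34.eventually_ge_atTop Y, h14.eventually_ge_atTop 8, eventually_ge_atTop 4]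
    with x hxY hx8 hx4 j
  have hx0 : 0 < x := by linarith
  have hlog : 0 < Real.log x := Real.log_pos (by linarith)
  have h1 := sum_theta_sub_le j (x := x) (by linarith)
  have e1 : x ^ (1 / 4 : ℝ) * x ^ (3 / 4 : ℝ) = x := by
    rw [← Real.rpow_add hx0]; norm_num
  have e2 : x ^ (1 / 4 : ℝ) * √x = x ^ (3 / 4 : ℝ) := by
    rw [Real.sqrt_eq_rpow, ← Real.rpow_add hx0]; norm_num
  have h2 : x / 4 * recipSum j (x ^ (1 / 4 : ℝ)) ≤
      ∑ m ∈ omegaLevel j (x ^ (1 / 4 : ℝ)), (Chebyshev.theta (x / m) - Chebyshev.theta (√x)) := by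
    rw [recipSum, Finset.mul_sum]
    refine sum_le_sum fun m hm => ?_
    rw [mem_omegaLevel] at hm
    have hm0 : (0 : ℝ) < m := by exact_mod_cast hm.1
    have h3 : x ^ (3 / 4 : ℝ) ≤ x / m := by
      rw [le_div_iff₀ hm0, mul_comm]
      calc (m : ℝ) * x ^ (3 / 4 : ℝ) ≤ x ^ (1 / 4 : ℝ) * x ^ (3 / 4 : ℝ) := by
            gcongr; exact hm.2.1
        _ = x := e1
    have h4 := hY (x / m) (hxY.trans h3)
    have h5 := Chebyshev.theta_le_log4_mul_x (Real.sqrt_nonneg x)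
    have h6 : Real.log 4 ≤ 2 := by
      rw [show (4 : ℝ) = 2 ^ 2 by norm_num, Real.log_pow]
      have := Real.log_two_lt_d9
      push_cast; linarith
    have h7 : Real.log 4 * √x ≤ 2 * √x := by gcongr
    have h8 : 8 * √x ≤ x ^ (3 / 4 : ℝ) := by rw [← e2]; gcongr
    have h9 : x / 4 * (1 / m) = (x / m) / 4 := by ring
    rw [h9]
    linarith
  have h3 := h2.trans h1
  rw [← div_div, div_mul_eq_mul_div, div_le_iff₀ hlog]
  linarith

theorem card_omegaLevel_le (j : ℕ) {y : ℝ} (hy : 0 ≤ y) : ((omegaLevel j y).card : ℝ) ≤ y := by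
  refine le_trans ?_ (Nat.floor_le hy)
  exact_mod_cast (Finset.card_filter_le _ _).trans (by simp)

theorem piky_le (j : ℕ) {x e z : ℝ} (hx : 1 < x) (he0 : 0 < e) (he1 : e ≤ 1) (hz1 : 1 ≤ z)
    (hz : z ≤ x ^ (e / 4)) :
    (piky (j + 1) x (x ^ (1 - e)) : ℝ) ≤ x ^ (1 - e / 2) +
      2 / Real.log x * (50 * x * (recipSum j x - recipSum j z) +
        3 * x ^ (3 / 4 : ℝ) * Real.log x ^ 2) := by
  classical
  have hx0 : 0 < x := by linarith
  have hlog : 0 < Real.log x := Real.log_pos hx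
  have hzq : z ≤ x ^ (1 / 4 : ℝ) :=
    hz.trans (Real.rpow_le_rpow_of_exponent_le hx.le (by linarith))
  have hzx : z ≤ x := hzq.trans (Real.rpow_le_self_of_one_le hx.le (by norm_num))
  set A := (omegaLevel (j + 1) x).filter
    fun n => ∀ p ∈ n.primeFactors, ((p : ℕ) : ℝ) ≤ x ^ (1 - e) with hA
  have hpiky : piky (j + 1) x (x ^ (1 - e)) = A.card := by
    rw [hA, omegaLevel, Finset.filter_filter, piky]
  set A₁ := A.filter fun n : ℕ => ¬ x ^ (1 - e / 2) < (n : ℝ) with hA₁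
  set A₂ := A.filter fun n : ℕ => x ^ (1 - e / 2) < (n : ℝ) with hA₂
  have hcard : (A.card : ℝ) = A₂.card + A₁.card := by
    rw [← Finset.card_filter_add_card_filter_not (s := A)
      (fun n : ℕ => x ^ (1 - e / 2) < (n : ℝ))]
    push_cast
    rfl
  have hsmall : (A₁.card : ℝ) ≤ x ^ (1 - e / 2) := by
    refine le_trans ?_ (card_omegaLevel_le (j + 1) (Real.rpow_nonneg hx0.le _))
    refine Nat.cast_le.2 (Finset.card_le_card fun n hn => ?_)
    simp only [hA₁, hA, Finset.mem_filter, mem_omegaLevel, not_lt] at hn ⊢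
    exact ⟨hn.1.1.1, hn.2, hn.1.1.2.2⟩
  set g : ℕ → ℝ := fun n => if n ∈ A₂ then 1 else 0 with hg
  have hg0 (n : ℕ) : 0 ≤ g n := by simp only [hg]; split_ifs <;> norm_num
  have hg1 (n : ℕ) : g n ≤ 1 := by simp only [hg]; split_ifs <;> norm_num
  have hlower : Real.log x / 2 * A₂.card ≤
      ∑ n ∈ omegaLevel (j + 1) x, Real.log n * g n := by
    calc Real.log x / 2 * A₂.card = ∑ n ∈ A₂, Real.log x / 2 := by
          rw [Finset.sum_const, nsmul_eq_mul, mul_comm]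
      _ ≤ ∑ n ∈ A₂, Real.log n * g n := by
          refine sum_le_sum fun n hn => ?_
          have hgn : g n = 1 := if_pos hn
          rw [hgn, mul_one]
          have hn2 := (Finset.mem_filter.1 hn).2
          have := Real.log_le_log (Real.rpow_pos_of_pos hx0 _) hn2.le
          rw [Real.log_rpow hx0] at this
          nlinarith
      _ ≤ _ := by
          refine sum_le_sum_of_subset_of_nonneg ?_ fun n _ _ =>
            mul_nonneg (Real.log_natCast_nonneg n) (hg0 n)
          exact (Finset.filter_subset _ _).trans (Finset.filter_subset _ _)
  have hupper := hlower.trans (sum_log_mul_le j x g hg0)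
  rw [← Finset.sum_filter_add_sum_filter_not (omegaLevel j x) (fun m : ℕ => z < (m : ℝ))] at hupper
  have hbig : ∑ m ∈ (omegaLevel j x).filter (fun m : ℕ => z < (m : ℝ)),
      ∑ q ∈ Finset.Icc 1 ⌊x / m⌋₊, primePowLog q * g (q * m) ≤
      50 * x * (recipSum j x - recipSum j z) := by
    rw [recipSum_sub_eq hzx, Finset.mul_sum]
    refine sum_le_sum fun m _ => ?_
    calc _ ≤ ∑ q ∈ Finset.Icc 1 ⌊x / m⌋₊, primePowLog q :=
          sum_le_sum fun q _ => mul_le_of_le_one_right (primePowLog_nonneg q) (hg1 _)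
      _ ≤ 50 * (x / m) := sum_primePowLog_le (by positivity)
      _ = _ := by ring
  have hlow : ∑ m ∈ (omegaLevel j x).filter (fun m : ℕ => ¬ z < (m : ℝ)),
      ∑ q ∈ Finset.Icc 1 ⌊x / m⌋₊, primePowLog q * g (q * m) ≤
      3 * x ^ (3 / 4 : ℝ) * Real.log x ^ 2 := by
    have hinner : ∀ m ∈ (omegaLevel j x).filter (fun m : ℕ => ¬ z < (m : ℝ)),
        ∑ q ∈ Finset.Icc 1 ⌊x / m⌋₊, primePowLog q * g (q * m) ≤
          3 * √x * Real.log x ^ 2 := by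
      intro m hm
      rw [Finset.mem_filter, mem_omegaLevel, not_lt] at hm
      obtain ⟨⟨hm1, hmx, -⟩, hmz⟩ := hm
      have hm0 : (1 : ℝ) ≤ m := by exact_mod_cast hm1
      have hxm : x / m ≤ x := div_le_self hx0.le hm0
      have h1xm : 1 ≤ x / m := by rwa [le_div_iff₀ (by linarith), one_mul]
      calc _ ≤ ∑ q ∈ Finset.Icc 1 ⌊x / m⌋₊ with ¬ q.Prime, primePowLog q := by
            rw [Finset.sum_filter]
            refine sum_le_sum fun q hq => ?_
            split_ifs with hqp
            · have : q * m ∉ A₂ := by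
                intro hmem
                simp only [hA₂, hA, Finset.mem_filter] at hmem
                have hqle := hmem.1.2 q (Nat.mem_primeFactors.2
                  ⟨hqp, Dvd.intro _ rfl, Nat.mul_ne_zero hqp.ne_zero (by omega)⟩)
                have hlt := hmem.2
                push_cast at hlt
                have : (q : ℝ) * m ≤ x ^ (1 - e) * x ^ (e / 4) := by
                  gcongr
                  exact hmz.trans hz
                rw [← Real.rpow_add hx0] at this
                have h' : x ^ (1 - e + e / 4) ≤ x ^ (1 - e / 2) :=
                  Real.rpow_le_rpow_of_exponent_le hx.le (by linarith)
                linarith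
              simp [hg, this]
            · exact mul_le_of_le_one_right (primePowLog_nonneg q) (hg1 _)
        _ ≤ 3 * √(x / m) * Real.log (x / m) ^ 2 := sum_primePowLog_not_prime_le h1xm
        _ ≤ 3 * √x * Real.log x ^ 2 := by
            have := Real.log_nonneg h1xm
            gcongr
    have hc : (((omegaLevel j x).filter (fun m : ℕ => ¬ z < (m : ℝ))).card : ℝ) ≤ z := by
      refine le_trans ?_ (card_omegaLevel_le j (by linarith : (0 : ℝ) ≤ z))
      refine Nat.cast_le.2 (Finset.card_le_card fun n hn => ?_)
      simp only [Finset.mem_filter, mem_omegaLevel, not_lt] at hn ⊢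
      exact ⟨hn.1.1, hn.2, hn.1.2.2⟩
    have e2 : x ^ (1 / 4 : ℝ) * √x = x ^ (3 / 4 : ℝ) := by
      rw [Real.sqrt_eq_rpow, ← Real.rpow_add hx0]; norm_num
    refine (Finset.sum_le_card_nsmul _ _ _ hinner).trans ?_
    rw [nsmul_eq_mul, ← e2]
    calc _ ≤ x ^ (1 / 4 : ℝ) * (3 * √x * Real.log x ^ 2) := by
          gcongr
          exact hc.trans hzq
      _ = _ := by ring
  have hfin : (A₂.card : ℝ) ≤ 2 / Real.log x * (50 * x * (recipSum j x - recipSum j z) +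
      3 * x ^ (3 / 4 : ℝ) * Real.log x ^ 2) := by
    rw [div_mul_eq_mul_div, le_div_iff₀ hlog]
    linarith
  rw [hpiky, hcard]
  linarith

theorem eventually_mul_exp_neg_sqrt_le {η : ℝ} (hη : 0 < η) :
    ∀ᶠ u : ℝ in atTop, u * Real.exp (-(√u / 2)) ≤ η := by
  have h := Real.tendsto_pow_mul_exp_neg_atTop_nhds_zero 2
  have ht : Tendsto (fun u : ℝ => √u / 2) atTop atTop :=
    Real.tendsto_sqrt_atTop.atTop_div_const (by norm_num)
  filter_upwards [(h.comp ht).eventually_lt_const (show (0 : ℝ) < η / 4 by positivity),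
    eventually_ge_atTop 0] with u hu hu0
  simp only [Function.comp] at hu
  rw [div_pow, Real.sq_sqrt hu0] at hu
  linarith

theorem eventually_sq_mul_exp_neg_le {η : ℝ} (hη : 0 < η) :
    ∀ᶠ u : ℝ in atTop, 6 * u ^ 2 * Real.exp (-(u / 4)) ≤ η := by
  have h := Real.tendsto_pow_mul_exp_neg_atTop_nhds_zero 2
  have ht : Tendsto (fun u : ℝ => u / 4) atTop atTop := tendsto_id.atTop_div_const (by norm_num)
  filter_upwards [(h.comp ht).eventually_lt_const (show (0 : ℝ) < η / 96 by positivity)] with u hu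
  simp only [Function.comp] at hu
  rw [div_pow] at hu
  linarith

theorem one_le_log_one_div {e : ℝ} (he0 : 0 < e) (he : e ≤ 1 / 3) : 1 ≤ Real.log (1 / e) := by
  rw [Real.le_log_iff_exp_le (by positivity), le_div_iff₀ he0]
  nlinarith [Real.exp_one_lt_d9]

/-- A dyadic exponent just below `e / 4`. -/
theorem exists_half_pow_near {e : ℝ} (he0 : 0 < e) (he : e ≤ 1 / 3) :
    ∃ i : ℕ, (1 / 2 : ℝ) ^ i ≤ e / 4 ∧ e / 8 ≤ (1 / 2 : ℝ) ^ i ∧ (i : ℝ) ≤ 5 * Real.log (1 / e) := by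
  obtain ⟨n, h1, h2⟩ := exists_nat_pow_near_of_lt_one (x := e / 4) (y := (1 / 2 : ℝ))
    (by positivity) (by linarith) (by norm_num) (by norm_num)
  have h3 : e / 8 ≤ (1 / 2 : ℝ) ^ (n + 1) := by rw [pow_succ]; linarith
  refine ⟨n + 1, h1.le, h3, ?_⟩
  have h4 := Real.log_le_log (by positivity) h3
  have h8 : Real.log 8 = 3 * Real.log 2 := by
    rw [show (8 : ℝ) = 2 ^ 3 by norm_num, Real.log_pow]; norm_num
  rw [Real.log_pow, Real.log_div he0.ne' (by norm_num), h8, one_div, Real.log_inv] at h4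
  have h5 := Real.log_two_gt_d9
  have h6 := one_le_log_one_div he0 he
  rw [one_div, Real.log_inv] at h6 ⊢
  have h7 : (0 : ℝ) ≤ ((n + 1 : ℕ) : ℝ) := Nat.cast_nonneg _
  nlinarith

theorem sqrt_le_mul_of_log_inv_le {e u : ℝ} (he0 : 0 < e) (hu : 0 < u)
    (h : Real.log (1 / e) ≤ Real.log u / 2) : √u ≤ e * u := by
  have h1 : 1 / e ≤ √u := by
    rw [← Real.log_sqrt hu.le] at h
    exact (Real.log_le_log_iff (by positivity) (Real.sqrt_pos.2 hu)).1 h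
  rw [div_le_iff₀ he0] at h1
  have h2 := Real.mul_self_sqrt hu.le
  nlinarith [Real.sqrt_nonneg u]

/-- Quantitative comparison of the restricted and unrestricted counts. -/
theorem piky_le_mul_pik {x e η : ℝ} {j : ℕ} (hη0 : 0 < η) (hη : η ≤ 1 / 20000)
    (hx : 4 ≤ x) (hL : 4 ≤ Real.log (Real.log x)) (hlog64 : 64 ≤ Real.log x)
    (he0 : 0 < e) (he : e ≤ 1 / 3)
    (hke : ((j + 1 : ℕ) : ℝ) * Real.log (1 / e) ≤ η * Real.log (Real.log x))
    (hexp1 : Real.log x * Real.exp (-(√(Real.log x) / 2)) ≤ η)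
    (hexp2 : 6 * Real.log x ^ 2 * Real.exp (-(Real.log x / 4)) ≤ η)
    (hpik : x / (4 * Real.log x) * recipSum j (x ^ (1 / 4 : ℝ)) ≤ pik (j + 1) x) :
    (piky (j + 1) x (x ^ (1 - e)) : ℝ) ≤ 20000000 * η * pik (j + 1) x := by
  have hx0 : 0 < x := by linarith
  set u := Real.log x with hu
  set L := Real.log u with hLdef
  set ℓ := Real.log (1 / e) with hℓ
  have hu0 : 0 < u := by linarith
  have hℓ1 : 1 ≤ ℓ := one_le_log_one_div he0 he
  push_cast at hke
  have hj0 : (0 : ℝ) ≤ j := Nat.cast_nonneg j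
  have hjL : (j : ℝ) ≤ L / 20000 := by nlinarith
  have hℓL : ℓ ≤ L / 2 := by nlinarith
  have heu : √u ≤ e * u := sqrt_le_mul_of_log_inv_le he0 hu0 hℓL
  have hsqu : 8 ≤ √u := Real.le_sqrt_of_sq_le (by linarith)
  have hpow (t : ℝ) : x ^ t = Real.exp (u * t) := Real.rpow_def_of_pos hx0 t
  obtain ⟨i, hi1, hi2, hi3⟩ := exists_half_pow_near he0 he
  have hz2 : 2 ≤ x ^ ((1 / 2 : ℝ) ^ i) := by
    rw [hpow]
    have : 1 ≤ u * (1 / 2 : ℝ) ^ i := by nlinarith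
    linarith [Real.add_one_le_exp (u * (1 / 2 : ℝ) ^ i)]
  have hup := piky_le j (x := x) (e := e) (z := x ^ ((1 / 2 : ℝ) ^ i)) (by linarith) he0
    (by linarith) (by linarith) (Real.rpow_le_rpow_of_exponent_le (by linarith) hi1)
  have hS1 := one_le_recipSum j hx hL hjL
  set S := recipSum j x with hS
  have hD : S - recipSum j (x ^ ((1 / 2 : ℝ) ^ i)) ≤ 16000 * η * S := by
    refine (recipSum_sub_rpow_le j i hx hL hjL hz2).trans ?_
    gcongr
    rw [div_le_iff₀ (by linarith)]
    nlinarith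
  have hquart : S / 2 ≤ recipSum j (x ^ (1 / 4 : ℝ)) := by
    have h4 : x ^ ((1 / 2 : ℝ) ^ 2) = x ^ (1 / 4 : ℝ) := by norm_num
    have h := recipSum_sub_rpow_le j 2 hx hL hjL (by
      rw [hpow]
      linarith [Real.add_one_le_exp (u * (1 / 2 : ℝ) ^ 2)])
    rw [h4] at h
    have h5 : 3200 * ((2 : ℕ) : ℝ) * j / L ≤ 1 / 2 := by
      rw [div_le_iff₀ (by linarith)]
      push_cast
      linarith
    have h6 := mul_le_mul_of_nonneg_right h5 (show 0 ≤ S by linarith)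
    linarith
  have hlow : x / u * S ≤ 8 * pik (j + 1) x := by
    have h1 : x / (4 * u) * (S / 2) ≤ pik (j + 1) x := le_trans (by gcongr) hpik
    have h2 : x / (4 * u) * (S / 2) = x / u * S / 8 := by field_simp; norm_num
    linarith
  have hxu : 0 < x / u := by positivity
  have hE : x ^ (1 - e / 2) ≤ η * (x / u) := by
    rw [Real.rpow_sub hx0, Real.rpow_one, hpow, div_eq_mul_inv, ← Real.exp_neg]
    have h1 : Real.exp (-(u * (e / 2))) ≤ Real.exp (-(√u / 2)) := by
      apply Real.exp_le_exp.2
      linarith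
    have h2 : Real.exp (-(√u / 2)) ≤ η / u := by
      rw [le_div_iff₀ hu0]; linarith
    calc x * Real.exp (-(u * (e / 2))) ≤ x * (η / u) := by gcongr; linarith
      _ = _ := by ring
  have hF : 2 / u * (3 * x ^ (3 / 4 : ℝ) * u ^ 2) ≤ η * (x / u) := by
    have h1 : x ^ (3 / 4 : ℝ) = x * Real.exp (-(u / 4)) := by
      rw [show (3 / 4 : ℝ) = 1 - 1 / 4 by norm_num, Real.rpow_sub hx0, Real.rpow_one, hpow,
        div_eq_mul_inv, ← Real.exp_neg]
      ring_nf
    rw [h1]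
    calc _ = 6 * u ^ 2 * Real.exp (-(u / 4)) * (x / u) := by ring
      _ ≤ _ := by gcongr
  have hG : 2 / u * (50 * x * (S - recipSum j (x ^ ((1 / 2 : ℝ) ^ i)))) ≤
      1600000 * η * (x / u * S) := by
    calc _ ≤ 2 / u * (50 * x * (16000 * η * S)) := by gcongr
      _ = _ := by ring
  have hH : η * (x / u) ≤ η * (x / u * S) := by
    gcongr
    exact le_mul_of_one_le_right hxu.le hS1
  have hT : (piky (j + 1) x (x ^ (1 - e)) : ℝ) ≤ 1600002 * η * (x / u * S) := by
    rw [mul_add] at hup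
    linarith
  refine hT.trans ?_
  have hp : (0 : ℝ) ≤ pik (j + 1) x := Nat.cast_nonneg _
  calc 1600002 * η * (x / u * S) ≤ 1600002 * η * (8 * pik (j + 1) x) := by gcongr
    _ ≤ _ := by nlinarith [mul_nonneg hη0.le hp]

/-- If `ε_x = o(1)`, `k ≥ 1` and `k log(1/ε_x) = o(log log x)` as `x → ∞`, then
`π_k(x, x^{1−ε_x}) = o(π_k(x))`. -/
theorem stmt_7 (ε : ℝ → ℝ) (k : ℝ → ℕ)
    (hεpos : ∀ x, 0 < ε x)
    (hε : Tendsto ε atTop (nhds 0))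
    (hk1 : ∀ x, 1 ≤ k x)
    (hko : (fun x => (k x : ℝ) * Real.log (1 / ε x))
      =o[atTop] fun x => Real.log (Real.log x)) :
    (fun x => (piky (k x) x (x ^ (1 - ε x)) : ℝ))
      =o[atTop] fun x => (pik (k x) x : ℝ) := by
  rw [isLittleO_iff]
  intro c hc
  set η : ℝ := min (1 / 20000) (c / 20000000) with hη
  have hη0 : 0 < η := by positivity
  have hloglog := Real.tendsto_log_atTop.comp Real.tendsto_log_atTop
  filter_upwards [hko.bound hη0, eventually_le_pik, eventually_ge_atTop 4,
    hloglog.eventually_ge_atTop 4, Real.tendsto_log_atTop.eventually_ge_atTop 64,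
    hε.eventually_le_const (show (0 : ℝ) < 1 / 3 by norm_num),
    Real.tendsto_log_atTop.eventually (eventually_mul_exp_neg_sqrt_le hη0),
    Real.tendsto_log_atTop.eventually (eventually_sq_mul_exp_neg_le hη0)]
    with x hk hpik hx hL h64 he h1 h2
  simp only [Function.comp] at hL
  obtain ⟨j, hj⟩ : ∃ j, k x = j + 1 := ⟨k x - 1, by have := hk1 x; omega⟩
  rw [hj] at hk ⊢
  have h3 := piky_le_mul_pik hη0 (min_le_left _ _) hx hL h64 (hεpos x) he
    ((le_abs_self _).trans (hk.trans (by rw [Real.norm_of_nonneg (by linarith)]))) h1 h2 (hpik j)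
  rw [Real.norm_of_nonneg (Nat.cast_nonneg _), Real.norm_of_nonneg (Nat.cast_nonneg _)]
  refine h3.trans ?_
  gcongr
  have := min_le_right (1 / 20000 : ℝ) (c / 20000000)
  linarith
end

section
/- Uniformly for x ≥ 3, 1/log₂ x < ε ≤ 1/2, 1 ≤ k ≪ log₂ x, setting r := k/log₂ x and n_ε := ∏_{p ≤ x^ε, p^ν ∥ n} p^ν, the conditions ω(n_ε) > k − 2r·log(1/ε) and n_ε ≤ x^{√ε} hold for all but at most O(ε^{r(log 4 − 1)} · π_k(x)) integers n in {n ≤ x : ω(n) = k}. -/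
open Finset Real

/-- The `y`-smooth part of `n`: the product of prime powers `p^ν ∥ n` with `p ≤ y`. -/
noncomputable def smoothPart (y : ℝ) (n : ℕ) : ℕ :=
  ∏ p ∈ n.primeFactors.filter (fun p => ((p : ℕ) : ℝ) ≤ y), p ^ (n.factorization p)

theorem sum_primes_log_div_le (N : ℕ) (hN : 1 ≤ N) :
    ∑ p ∈ N.primesLE, log p / p ≤ log N + log 4 := by
  have hN0 : (0 : ℝ) < N := by exact_mod_cast hN
  have h1 : ∑ p ∈ N.primesLE, ((N : ℝ) / p - 1) * log p ≤ N * log N := by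
    calc ∑ p ∈ N.primesLE, ((N : ℝ) / p - 1) * log p
        ≤ ∑ p ∈ N.primesLE, (N.factorial.factorization p : ℝ) * log p := by
          refine sum_le_sum fun p hp => ?_
          obtain ⟨hpN, hp⟩ := Nat.mem_primesLE.1 hp
          refine mul_le_mul_of_nonneg_right ?_ (log_natCast_nonneg p)
          have h2 : N / p ≤ N.factorial.factorization p := by
            rw [Nat.factorization_factorial hp (Nat.lt_succ_self _)]
            refine le_trans (by simp) (single_le_sum (f := fun i => N / p ^ i) (fun _ _ => Nat.zero_le _)
              (Finset.mem_Ico.2 ⟨le_refl 1, ?_⟩))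
            have := Nat.log_pos hp.one_lt hpN
            omega
          have h3 : (N : ℝ) / p < (N / p : ℕ) + 1 := by
            rw [div_lt_iff₀ (by exact_mod_cast hp.pos)]
            exact_mod_cast Nat.lt_mul_of_div_lt (Nat.lt_succ_self _) hp.pos
          have h4 : ((N / p : ℕ) : ℝ) ≤ N.factorial.factorization p := by exact_mod_cast h2
          linarith
      _ = log N.factorial := by
          rw [log_nat_eq_sum_factorization, Finsupp.sum]
          symm
          refine sum_subset ?_ ?_
          · intro p hp
            simp only [Nat.support_factorization, Nat.mem_primeFactors] at hp
            exact Nat.mem_primesLE.2 ⟨(hp.1.dvd_factorial).1 hp.2.1, hp.1⟩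
          · intro p _ hp
            simp only [Finsupp.mem_support_iff, not_not] at hp
            simp [hp]
      _ ≤ log ((N : ℝ) ^ N) := by
          refine log_le_log (by positivity) ?_
          exact_mod_cast Nat.factorial_le_pow N
      _ = N * log N := by rw [log_pow]
  have h2 : ∑ p ∈ N.primesLE, log p ≤ log 4 * N := by
    rw [← Chebyshev.theta_eq_sum_primesLE_log]
    exact Chebyshev.theta_le_log4_mul_x hN0.le
  have h3 : N * ∑ p ∈ N.primesLE, log p / p =
      ∑ p ∈ N.primesLE, ((N : ℝ) / p - 1) * log p + ∑ p ∈ N.primesLE, log p := by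
    rw [mul_sum, ← sum_add_distrib]
    refine sum_congr rfl fun p _ => by ring
  have : N * ∑ p ∈ N.primesLE, log p / p ≤ N * (log N + log 4) := by rw [h3]; linarith
  exact le_of_mul_le_mul_left this hN0

theorem exists_log_sub_le_sum_primes_log_div :
    ∃ C : ℝ, ∀ N : ℕ, 1 ≤ N → log N - C ≤ ∑ p ∈ N.primesLE, log p / p := by
  have hsum : Summable fun n : ℕ => 4 * (1 / (n : ℝ) ^ (3 / 2 : ℝ)) :=
    (Real.summable_one_div_nat_rpow.2 (by norm_num)).mul_left 4
  refine ⟨1 + ∑' n : ℕ, 4 * (1 / (n : ℝ) ^ (3 / 2 : ℝ)), fun N hN => ?_⟩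
  have hN0 : (0 : ℝ) < N := by exact_mod_cast hN
  have h1 : log N - 1 ≤ ∑ p ∈ N.primesLE, log p / (p - 1) := by
    have hf : N * (log N - 1) ≤ log N.factorial := by
      have := pow_div_factorial_le_exp _ hN0.le N
      have h2 := log_le_log (by positivity) this
      rw [log_exp, log_div (by positivity) (by positivity), log_pow] at h2
      linarith
    have h3 : log N.factorial ≤ N * ∑ p ∈ N.primesLE, log p / (p - 1) := by
      rw [log_nat_eq_sum_factorization, Finsupp.sum, mul_sum]
      refine (sum_le_sum_of_subset_of_nonneg (t := N.primesLE) ?_ ?_).trans ?_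
      · intro p hp
        simp only [Nat.support_factorization, Nat.mem_primeFactors] at hp
        exact Nat.mem_primesLE.2 ⟨(hp.1.dvd_factorial).1 hp.2.1, hp.1⟩
      · intros
        positivity
      · refine sum_le_sum fun p hp => ?_
        obtain ⟨hpN, hp⟩ := Nat.mem_primesLE.1 hp
        have hp1 : (1 : ℝ) < p := by exact_mod_cast hp.one_lt
        have h4 : (p - 1) * N.factorial.factorization p ≤ N := by
          rw [Nat.sub_one_mul_factorization_factorial hp]; exact Nat.sub_le _ _
        have h5 : ((p : ℝ) - 1) * N.factorial.factorization p ≤ N := by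
          have : (((p - 1 : ℕ) : ℝ)) * N.factorial.factorization p ≤ N := by exact_mod_cast h4
          rwa [Nat.cast_sub hp.one_lt.le, Nat.cast_one] at this
        have h6 : (N.factorial.factorization p : ℝ) ≤ N / (p - 1) := by
          rw [le_div_iff₀ (by linarith)]; linarith
        calc _ ≤ (N : ℝ) / (p - 1) * log p := mul_le_mul_of_nonneg_right h6 (log_natCast_nonneg p)
          _ = _ := by ring
    exact le_of_mul_le_mul_left (hf.trans h3) hN0
  have h2 : ∑ p ∈ N.primesLE, log p / (p - 1) ≤ ∑ p ∈ N.primesLE, log p / p +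
      ∑ p ∈ N.primesLE, 4 * (1 / (p : ℝ) ^ (3 / 2 : ℝ)) := by
    rw [← sum_add_distrib]
    refine sum_le_sum fun p hp => ?_
    obtain ⟨hpN, hp⟩ := Nat.mem_primesLE.1 hp
    have hp2 : (2 : ℝ) ≤ p := by exact_mod_cast hp.two_le
    have hp0 : (0 : ℝ) < p := by linarith
    have h7 : log p ≤ 2 * (p : ℝ) ^ (1 / 2 : ℝ) := by
      have := log_le_rpow_div hp0.le (ε := 1 / 2) (by norm_num)
      linarith
    have h8 : log p / ((p : ℝ) - 1) - log p / p = log p / (p * (p - 1)) := by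
      field_simp [show (p : ℝ) - 1 ≠ 0 by linarith]
      ring
    have h9 : log p / ((p : ℝ) * (p - 1)) ≤ 2 * (p : ℝ) ^ (1 / 2 : ℝ) / (p ^ 2 / 2) := by
      refine div_le_div₀ (by positivity) h7 (by positivity) (by nlinarith)
    have h10 : 2 * (p : ℝ) ^ (1 / 2 : ℝ) / (p ^ 2 / 2) = 4 * (1 / (p : ℝ) ^ (3 / 2 : ℝ)) := by
      have : (p : ℝ) ^ 2 = (p : ℝ) ^ (3 / 2 : ℝ) * (p : ℝ) ^ (1 / 2 : ℝ) := by
        rw [← rpow_add hp0, ← rpow_natCast]; norm_num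
      rw [this]
      field_simp
      ring
    linarith
  have h3 := hsum.sum_le_tsum N.primesLE (fun i _ => by positivity)
  linarith

/-- Mertens' second theorem for natural `N`. -/
theorem exists_abs_sum_primes_inv_sub_le_nat :
    ∃ C : ℝ, ∀ N : ℕ, 2 ≤ N → |∑ p ∈ N.primesLE, 1 / (p : ℝ) - log (log N)| ≤ C := by
  obtain ⟨C₀, hC₀⟩ := exists_log_sub_le_sum_primes_log_div
  set C := max C₀ (log 4) with hC
  set A : ℕ → ℝ := fun N => ∑ p ∈ N.primesLE, log p / p with hA
  set E : ℕ → ℝ := fun N => A N - log N with hE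
  set B : ℕ → ℝ := fun N => ∑ p ∈ N.primesLE, 1 / (p : ℝ) with hB
  have hEC : ∀ N, 1 ≤ N → |E N| ≤ C := fun N hN => by
    rw [abs_le]
    have h1 := hC₀ N hN
    have h2 := sum_primes_log_div_le N hN
    have := le_max_left C₀ (log 4)
    have := le_max_right C₀ (log 4)
    simp only [hE, hA]
    constructor <;> linarith
  have hC0 : 0 ≤ C := le_trans (log_nonneg (by norm_num)) (le_max_right _ _)
  have hstep : ∀ N : ℕ, 2 ≤ N → B (N + 1) - E (N + 1) / log (N + 1 : ℕ) - (B N - E N / log N) =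
      (log (N + 1 : ℕ) - log N) / log (N + 1 : ℕ) + E N * (1 / log N - 1 / log (N + 1 : ℕ)) := by
    intro N hN
    have hl1 : 0 < log (N + 1 : ℕ) := log_pos (by exact_mod_cast (by omega))
    have hBA : B (N + 1) - B N = (A (N + 1) - A N) / log (N + 1 : ℕ) := by
      simp only [hB, hA, Nat.primesLE_succ]
      split_ifs with hp
      · rw [sum_insert (Nat.notMem_primesLE N), sum_insert (Nat.notMem_primesLE N)]
        field_simp
        ring
      · simp
    simp only [hE]
    have : B (N + 1) = B N + (A (N + 1) - A N) / log (N + 1 : ℕ) := by linarith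
    rw [this]
    ring
  have key : ∀ N : ℕ, 2 ≤ N → |B N - E N / log N - log (log N)| ≤
      |B 2 - E 2 / log 2 - log (log 2)| + (C + 1) * (1 / log 2 - 1 / log N) := by
    intro N hN
    induction N, hN using Nat.le_induction with
    | base => simp
    | succ N hN ih =>
      have hN0 : (0 : ℝ) < N := by exact_mod_cast (by omega : 0 < N)
      have hl : 0 < log N := log_pos (by exact_mod_cast (by omega))
      have hl1 : 0 < log (N + 1 : ℕ) := log_pos (by exact_mod_cast (by omega))
      have hmono : log N < log (N + 1 : ℕ) := log_lt_log hN0 (by push_cast; linarith)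
      set a := log N
      set b := log (N + 1 : ℕ)
      have hba : b - a ≤ 1 := by
        have h1 : b - a = log ((N + 1 : ℕ) / N) := by
          rw [log_div (by positivity) (by positivity)]
        rw [h1]
        refine (log_le_sub_one_of_pos (by positivity)).trans ?_
        rw [sub_le_iff_le_add, div_le_iff₀ hN0]
        push_cast
        have : (1 : ℝ) ≤ N := by exact_mod_cast (by omega)
        linarith
      have u1 : log b - log a ≤ (b - a) / a := by
        rw [← log_div hl1.ne' hl.ne']
        refine (log_le_sub_one_of_pos (by positivity)).trans (le_of_eq ?_)
        field_simp
      have u2 : (b - a) / b ≤ log b - log a := by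
        have : log a - log b ≤ a / b - 1 := by
          rw [← log_div hl.ne' hl1.ne']
          exact log_le_sub_one_of_pos (by positivity)
        have h2 : (b - a) / b = 1 - a / b := by field_simp
        linarith
      have u3 : (b - a) / a - (b - a) / b ≤ 1 / a - 1 / b := by
        have h3 : 0 ≤ 1 / a - 1 / b := by
          rw [sub_nonneg]; exact one_div_le_one_div_of_le hl hmono.le
        have : (b - a) / a - (b - a) / b = (b - a) * (1 / a - 1 / b) := by ring
        rw [this]
        nlinarith
      have h3 : 0 ≤ 1 / a - 1 / b := by
          rw [sub_nonneg]; exact one_div_le_one_div_of_le hl hmono.le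
      have u4 : |E N * (1 / a - 1 / b)| ≤ C * (1 / a - 1 / b) := by
        rw [abs_mul, abs_of_nonneg h3]
        exact mul_le_mul_of_nonneg_right (hEC N (by omega)) h3
      have hs := hstep N hN
      have u5 : |(b - a) / b - (log b - log a)| ≤ 1 / a - 1 / b := by
        rw [abs_le]; constructor <;> linarith
      have : B (N + 1) - E (N + 1) / b - log b = (B N - E N / a - log a) +
          ((b - a) / b - (log b - log a)) + E N * (1 / a - 1 / b) := by linarith
      rw [this]
      refine (abs_add_three _ _ _).trans ?_
      linarith
  refine ⟨|B 2 - E 2 / log 2 - log (log 2)| + (C + 1) * (1 / log 2) + C / log 2, fun N hN => ?_⟩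
  have hl2 : 0 < log 2 := log_pos (by norm_num)
  have hl : log 2 ≤ log N := log_le_log (by norm_num) (by exact_mod_cast hN)
  have hl0 : 0 < log N := by linarith
  have h1 := key N hN
  have h2 : |E N / log N| ≤ C / log 2 := by
    rw [abs_div, abs_of_pos hl0]
    exact div_le_div₀ hC0 (hEC N (by omega)) hl2 hl
  have h3 : B N - log (log N) = (B N - E N / log N - log (log N)) + E N / log N := by ring
  have h4 : (C + 1) * (1 / log 2 - 1 / log N) ≤ (C + 1) * (1 / log 2) := by
    refine mul_le_mul_of_nonneg_left ?_ (by linarith)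
    have : 0 < 1 / log N := by positivity
    linarith
  change |B N - log (log N)| ≤ _
  rw [h3]
  refine (abs_add_le _ _).trans ?_
  linarith

/-- Mertens' second theorem. -/
theorem exists_abs_sum_primes_inv_sub_le :
    ∃ C : ℝ, 0 < C ∧ ∀ y : ℝ, 2 ≤ y →
      |∑ p ∈ (⌊y⌋₊).primesLE, 1 / (p : ℝ) - log (log y)| ≤ C := by
  obtain ⟨C, hC⟩ := exists_abs_sum_primes_inv_sub_le_nat
  have hl2 : 0 < log 2 := log_pos (by norm_num)
  have hC0 : 0 ≤ C := (abs_nonneg _).trans (hC 2 le_rfl)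
  refine ⟨C + 1 / log 2, by positivity, fun y hy => ?_⟩
  have hN : 2 ≤ ⌊y⌋₊ := Nat.le_floor (by simpa using hy)
  have h1 := hC _ hN
  set N := ⌊y⌋₊
  have hN2 : (2 : ℝ) ≤ N := by exact_mod_cast hN
  have hNy : (N : ℝ) ≤ y := Nat.floor_le (by linarith)
  have hyN : y < N + 1 := Nat.lt_floor_add_one y
  have hl : log 2 ≤ log N := log_le_log (by norm_num) hN2
  have hl' : log N ≤ log y := log_le_log (by linarith) hNy
  have h2 : log (log N) ≤ log (log y) := log_le_log (by linarith) hl'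
  have h3 : log (log y) - log (log N) ≤ 1 / log 2 := by
    rw [← log_div (by linarith) (by linarith)]
    refine (log_le_sub_one_of_pos (div_pos (by linarith) (by linarith))).trans ?_
    have h4 : log y - log N ≤ 1 := by
      rw [← log_div (by linarith) (by linarith)]
      refine (log_le_sub_one_of_pos (div_pos (by linarith) (by linarith))).trans ?_
      rw [sub_le_iff_le_add, div_le_iff₀ (by linarith)]
      linarith
    have h5 : log y / log N - 1 = (log y - log N) / log N := by
      rw [sub_div, div_self (by linarith)]
    rw [h5]
    exact div_le_div₀ zero_le_one h4 hl2 hl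
  rw [abs_le] at h1 ⊢
  constructor <;> linarith [h1.1, h1.2]

/-- The integers `1 ≤ n ≤ N` with `ω(n) = k`. -/
def natsWithOmega (k N : ℕ) : Finset ℕ :=
  (Finset.Icc 1 N).filter (fun n => n.primeFactors.card = k)

/-- The pairs `(p, a)` with `p` prime, `a ≥ 1` and `p ^ a ≤ N`. -/
def primePowerPairs (N : ℕ) : Finset (ℕ × ℕ) :=
  (N.primesLE ×ˢ Finset.Icc 1 N).filter (fun q => q.1 ^ q.2 ≤ N)

theorem mem_natsWithOmega {k N n : ℕ} :
    n ∈ natsWithOmega k N ↔ (1 ≤ n ∧ n ≤ N) ∧ n.primeFactors.card = k := by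
  simp [natsWithOmega]

theorem mem_primePowerPairs {N p a : ℕ} :
    (p, a) ∈ primePowerPairs N ↔ p.Prime ∧ 1 ≤ a ∧ p ^ a ≤ N := by
  simp only [primePowerPairs, mem_filter, mem_product, Nat.mem_primesLE, Finset.mem_Icc]
  constructor
  · rintro ⟨⟨⟨-, hp⟩, ha, -⟩, h⟩
    exact ⟨hp, ha, h⟩
  · rintro ⟨hp, ha, h⟩
    exact ⟨⟨⟨(Nat.le_self_pow (by omega) p).trans h, hp⟩, ha,
      (Nat.lt_pow_self hp.one_lt).le.trans h⟩, h⟩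

theorem primePowerPairs_mono {M N : ℕ} (h : M ≤ N) : primePowerPairs M ⊆ primePowerPairs N := by
  rintro ⟨p, a⟩ hq
  rw [mem_primePowerPairs] at hq ⊢
  exact ⟨hq.1, hq.2.1, hq.2.2.trans h⟩

/-- Summing over `n` together with one of its exact prime powers is dominated by summing over
the cofactor and the prime power independently. -/
theorem sum_ordCompl_le {k N : ℕ} (F : ℕ → ℕ → ℕ → ℝ) (hF : ∀ m p a, 0 ≤ F m p a) :
    ∑ n ∈ natsWithOmega (k + 1) N, ∑ p ∈ n.primeFactors,
        F (n / p ^ n.factorization p) p (n.factorization p) ≤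
      ∑ m ∈ natsWithOmega k N, ∑ q ∈ primePowerPairs (N / m), F m q.1 q.2 := by
  rw [sum_sigma', sum_sigma']
  let φ : (Σ _ : ℕ, ℕ) → (Σ _ : ℕ, ℕ × ℕ) := fun s =>
    ⟨s.1 / s.2 ^ s.1.factorization s.2, (s.2, s.1.factorization s.2)⟩
  have hinj : Set.InjOn φ ((natsWithOmega (k + 1) N).sigma fun n => n.primeFactors) := by
    rintro ⟨n, p⟩ hn ⟨n', p'⟩ hn' h
    simp only [φ, Sigma.mk.injEq, heq_eq_eq, Prod.mk.injEq] at h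
    obtain ⟨h1, rfl, h3⟩ := h
    have e1 := Nat.ordProj_mul_ordCompl_eq_self n p
    have e2 := Nat.ordProj_mul_ordCompl_eq_self n' p
    rw [h1, h3, e2] at e1
    rw [e1]
  have himg : ∑ s ∈ (natsWithOmega (k + 1) N).sigma fun n => n.primeFactors,
      F (s.1 / s.2 ^ s.1.factorization s.2) s.2 (s.1.factorization s.2) =
      ∑ t ∈ ((natsWithOmega (k + 1) N).sigma fun n => n.primeFactors).image φ,
        F t.1 t.2.1 t.2.2 := by
    rw [sum_image hinj]
  rw [himg]
  refine sum_le_sum_of_subset_of_nonneg ?_ fun _ _ _ => hF _ _ _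
  intro t ht
  obtain ⟨⟨n, p⟩, hs, rfl⟩ := mem_image.1 ht
  simp only [mem_sigma, mem_natsWithOmega] at hs
  obtain ⟨⟨⟨hn1, hnN⟩, hk⟩, hp⟩ := hs
  have hn0 : n ≠ 0 := by omega
  have hpp := Nat.prime_of_mem_primeFactors hp
  have hpd := Nat.dvd_of_mem_primeFactors hp
  have e1 := Nat.ordProj_mul_ordCompl_eq_self n p
  have hpos := Nat.ordCompl_pos p hn0
  simp only [φ, mem_sigma, mem_natsWithOmega, mem_primePowerPairs]
  refine ⟨⟨⟨hpos, (Nat.ordCompl_le n p).trans hnN⟩, ?_⟩, hpp,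
    hpp.factorization_pos_of_dvd hn0 hpd, ?_⟩
  · rw [← Nat.support_factorization, Nat.factorization_ordCompl, Finsupp.support_erase,
      Nat.support_factorization, card_erase_of_mem hp, hk]
    rfl
  · rw [Nat.le_div_iff_mul_le hpos, e1]
    exact hnN

theorem factorization_prod_nonneg {g : ℕ → ℕ → ℝ} (hg : ∀ p a, 0 ≤ g p a) (n : ℕ) :
    0 ≤ n.factorization.prod g :=
  prod_nonneg fun _ _ => hg _ _

theorem factorization_prod_eq_mul_ordCompl (g : ℕ → ℕ → ℝ) {n p : ℕ} (hp : p ∈ n.primeFactors) :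
    n.factorization.prod g =
      g p (n.factorization p) * (n / p ^ n.factorization p).factorization.prod g := by
  rw [Nat.factorization_ordCompl]
  exact (Finsupp.mul_prod_erase _ _ _ (by simpa using hp)).symm

theorem sum_weight_div_le {g : ℕ → ℕ → ℝ} (hg : ∀ p a, 0 ≤ g p a) (k N : ℕ) :
    ∑ m ∈ natsWithOmega k N, m.factorization.prod g / m ≤
      (∑ q ∈ primePowerPairs N, g q.1 q.2 / (q.1 : ℝ) ^ q.2) ^ k / k.factorial := by
  have hG := factorization_prod_nonneg hg
  set T := ∑ q ∈ primePowerPairs N, g q.1 q.2 / (q.1 : ℝ) ^ q.2 with hT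
  have hT0 : 0 ≤ T := sum_nonneg fun q _ => div_nonneg (hg _ _) (by positivity)
  induction k with
  | zero =>
    have : natsWithOmega 0 N ⊆ {1} := by
      intro n hn
      rw [mem_natsWithOmega, card_eq_zero, Nat.primeFactors_eq_empty] at hn
      simp; omega
    refine (sum_le_sum_of_subset_of_nonneg this fun _ _ _ =>
      div_nonneg (hG _) (Nat.cast_nonneg _)).trans ?_
    simp
  | succ k ih =>
    have h1 : ((k : ℝ) + 1) * ∑ m ∈ natsWithOmega (k + 1) N, m.factorization.prod g / m =
        ∑ n ∈ natsWithOmega (k + 1) N, ∑ p ∈ n.primeFactors,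
          (fun m p a : ℕ => m.factorization.prod g / (m : ℝ) * (g p a / (p : ℝ) ^ a))
            (n / p ^ n.factorization p) p (n.factorization p) := by
      rw [mul_sum]
      refine sum_congr rfl fun n hn => ?_
      rw [mem_natsWithOmega] at hn
      rw [sum_congr rfl (g := fun _ => n.factorization.prod g / (n : ℝ)), sum_const, hn.2]
      · simp
      · intro p hp
        have e1 : (n : ℝ) = (p : ℝ) ^ n.factorization p * ((n / p ^ n.factorization p : ℕ) : ℝ) := by
          exact_mod_cast (Nat.ordProj_mul_ordCompl_eq_self n p).symm
        rw [factorization_prod_eq_mul_ordCompl g hp]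
        conv_rhs => rw [e1]
        beta_reduce
        rw [div_mul_div_comm]
        congr 1 <;> ring
    have h2 := sum_ordCompl_le (k := k) (N := N)
      (fun m p a : ℕ => m.factorization.prod g / (m : ℝ) * (g p a / (p : ℝ) ^ a))
      (fun m p a => mul_nonneg (div_nonneg (hG _) (Nat.cast_nonneg _))
        (div_nonneg (hg _ _) (by positivity)))
    have h3 : ∑ m ∈ natsWithOmega k N, ∑ q ∈ primePowerPairs (N / m),
        m.factorization.prod g / (m : ℝ) * (g q.1 q.2 / (q.1 : ℝ) ^ q.2) ≤
        ∑ m ∈ natsWithOmega k N, m.factorization.prod g / (m : ℝ) * T := by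
      refine sum_le_sum fun m _ => ?_
      rw [← mul_sum]
      refine mul_le_mul_of_nonneg_left ?_ (div_nonneg (hG _) (Nat.cast_nonneg _))
      exact sum_le_sum_of_subset_of_nonneg (primePowerPairs_mono (Nat.div_le_self _ _))
        fun q _ _ => div_nonneg (hg _ _) (by positivity)
    rw [← sum_mul] at h3
    have h4 := mul_le_mul_of_nonneg_right ih hT0
    have h5 : ((k : ℝ) + 1) * ∑ m ∈ natsWithOmega (k + 1) N, m.factorization.prod g / m ≤
        T ^ k / k.factorial * T := by
      rw [h1]; exact h2.trans (h3.trans h4)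
    have h6 : T ^ (k + 1) / (k + 1).factorial = T ^ k / k.factorial * T / (k + 1) := by
      rw [Nat.factorial_succ]; push_cast; field_simp; ring
    rw [h6, le_div_iff₀ (by positivity)]
    linarith

theorem sum_weight_mul_log_le {g : ℕ → ℕ → ℝ} (hg : ∀ p a, 0 ≤ g p a) (k N : ℕ) {D : ℝ}
    (hD : 0 ≤ D)
    (h : ∀ M, ∑ q ∈ primePowerPairs M, g q.1 q.2 * (q.2 * log q.1) ≤ D * M) :
    ∑ n ∈ natsWithOmega (k + 1) N, n.factorization.prod g * log n ≤
      D * N * ((∑ q ∈ primePowerPairs N, g q.1 q.2 / (q.1 : ℝ) ^ q.2) ^ k / k.factorial) := by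
  have hG := factorization_prod_nonneg hg
  have h1 : ∑ n ∈ natsWithOmega (k + 1) N, n.factorization.prod g * log n =
      ∑ n ∈ natsWithOmega (k + 1) N, ∑ p ∈ n.primeFactors,
        (n / p ^ n.factorization p).factorization.prod g *
          (g p (n.factorization p) * ((n.factorization p : ℝ) * log p)) := by
    refine sum_congr rfl fun n _ => ?_
    rw [log_nat_eq_sum_factorization, Finsupp.sum, mul_sum, Nat.support_factorization]
    refine sum_congr rfl fun p hp => ?_
    rw [factorization_prod_eq_mul_ordCompl g hp]
    ring
  rw [h1]
  have h2 := sum_ordCompl_le (k := k) (N := N)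
    (fun m p a : ℕ => m.factorization.prod g * (g p a * ((a : ℝ) * log p)))
    (fun m p a => mul_nonneg (hG _) (mul_nonneg (hg _ _)
      (mul_nonneg (Nat.cast_nonneg _) (log_natCast_nonneg _))))
  refine h2.trans ?_
  refine le_trans ?_ (mul_le_mul_of_nonneg_left (sum_weight_div_le hg k N)
    (mul_nonneg hD (Nat.cast_nonneg N)))
  rw [mul_sum]
  refine sum_le_sum fun m hm => ?_
  rw [← mul_sum]
  refine (mul_le_mul_of_nonneg_left (h (N / m)) (hG m)).trans ?_
  have : ((N / m : ℕ) : ℝ) ≤ N / m := Nat.cast_div_le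
  calc m.factorization.prod g * (D * ((N / m : ℕ) : ℝ))
      ≤ m.factorization.prod g * (D * (N / m)) := by
        refine mul_le_mul_of_nonneg_left (mul_le_mul_of_nonneg_left this hD) (hG m)
    _ = _ := by ring

theorem sum_primePowerPairs_eq (f : ℕ × ℕ → ℝ) (N : ℕ) :
    ∑ q ∈ primePowerPairs N, f q = ∑ p ∈ N.primesLE, f (p, 1) +
      ∑ q ∈ (primePowerPairs N).filter (fun q => 2 ≤ q.2), f q := by
  rw [← sum_filter_add_sum_filter_not (primePowerPairs N) (fun q => 2 ≤ q.2), add_comm]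
  congr 1
  have : (primePowerPairs N).filter (fun q => ¬ 2 ≤ q.2) = N.primesLE.image (fun p => (p, 1)) := by
    ext ⟨p, a⟩
    simp only [mem_filter, mem_primePowerPairs, mem_image, Nat.mem_primesLE, Prod.mk.injEq]
    constructor
    · rintro ⟨⟨hp, ha, hN⟩, h2⟩
      obtain rfl : a = 1 := by omega
      exact ⟨p, ⟨by simpa using hN, hp⟩, rfl, rfl⟩
    · rintro ⟨p, ⟨hN, hp⟩, rfl, rfl⟩
      exact ⟨⟨hp, le_rfl, by simpa using hN⟩, by norm_num⟩
  rw [this, sum_image]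
  intro p _ p' _ h
  simpa using h

theorem exists_sum_higher_primePowers_le :
    ∃ K : ℝ, 0 < K ∧ ∀ N : ℕ, ∑ q ∈ (primePowerPairs N).filter (fun q => 2 ≤ q.2),
      ((q.1 : ℝ) ^ q.2) ^ (-(3 / 4) : ℝ) ≤ K := by
  set ρ : ℝ := 2 ^ (-(3 / 4) : ℝ) with hρ
  have hρ0 : 0 < ρ := by positivity
  have hρ1 : ρ < 1 := rpow_lt_one_of_one_lt_of_neg (by norm_num) (by norm_num)
  have hs1 : Summable fun n : ℕ => (n : ℝ) ^ (-(3 / 2) : ℝ) :=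
    Real.summable_nat_rpow.2 (by norm_num)
  have hs2 : Summable fun n : ℕ => ρ ^ n := summable_geometric_of_lt_one hρ0.le hρ1
  set S₁ := ∑' n : ℕ, (n : ℝ) ^ (-(3 / 2) : ℝ)
  set S₂ := ∑' n : ℕ, ρ ^ n
  have hS1 : 0 ≤ S₁ := tsum_nonneg fun n => by positivity
  have hS2 : 0 ≤ S₂ := tsum_nonneg fun n => by positivity
  refine ⟨S₁ * S₂ / ρ ^ 2 + 1, by positivity, fun N => ?_⟩
  calc ∑ q ∈ (primePowerPairs N).filter (fun q => 2 ≤ q.2), ((q.1 : ℝ) ^ q.2) ^ (-(3 / 4) : ℝ)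
      ≤ ∑ q ∈ (primePowerPairs N).filter (fun q => 2 ≤ q.2),
          (q.1 : ℝ) ^ (-(3 / 2) : ℝ) * (ρ ^ q.2 / ρ ^ 2) := by
        refine sum_le_sum ?_
        rintro ⟨p, a⟩ hq
        simp only [mem_filter, mem_primePowerPairs] at hq
        obtain ⟨⟨hp, -, -⟩, ha⟩ := hq
        obtain ⟨b, rfl⟩ := Nat.exists_eq_add_of_le ha
        have hp2 : (2 : ℝ) ≤ p := by exact_mod_cast hp.two_le
        have hp0 : (0 : ℝ) < p := by linarith
        have e1 : ((p : ℝ) ^ (2 + b)) ^ (-(3 / 4) : ℝ) =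
            (p : ℝ) ^ (-(3 / 2) : ℝ) * ((p : ℝ) ^ (-(3 / 4) : ℝ)) ^ b := by
          rw [pow_add, mul_rpow (by positivity) (by positivity)]
          congr 1
          · rw [← rpow_natCast, ← rpow_mul hp0.le]; norm_num
          · rw [← rpow_natCast, ← rpow_natCast, ← rpow_mul hp0.le, ← rpow_mul hp0.le, mul_comm]
        have e2 : ρ ^ (2 + b) / ρ ^ 2 = ρ ^ b := by
          rw [pow_add]; field_simp
        simp only [e1, e2]
        refine mul_le_mul_of_nonneg_left ?_ (by positivity)
        refine pow_le_pow_left₀ (by positivity) ?_ b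
        exact rpow_le_rpow_of_nonpos (by norm_num) hp2 (by norm_num)
    _ ≤ ∑ q ∈ N.primesLE ×ˢ Finset.Icc 1 N, (q.1 : ℝ) ^ (-(3 / 2) : ℝ) * (ρ ^ q.2 / ρ ^ 2) :=
        sum_le_sum_of_subset_of_nonneg
          ((filter_subset _ _).trans (filter_subset _ _)) fun _ _ _ => by positivity
    _ = (∑ p ∈ N.primesLE, (p : ℝ) ^ (-(3 / 2) : ℝ)) * ((∑ a ∈ Finset.Icc 1 N, ρ ^ a) / ρ ^ 2) := by
        rw [sum_product, sum_div, sum_mul_sum]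
    _ ≤ S₁ * (S₂ / ρ ^ 2) := by
        refine mul_le_mul (hs1.sum_le_tsum _ fun _ _ => by positivity) ?_ ?_ hS1
        · exact div_le_div_of_nonneg_right (hs2.sum_le_tsum _ fun _ _ => by positivity)
            (by positivity)
        · exact div_nonneg (sum_nonneg fun _ _ => by positivity) (by positivity)
    _ ≤ S₁ * S₂ / ρ ^ 2 + 1 := by rw [mul_div_assoc]; linarith

theorem exists_primePower_weight_bounds :
    ∃ D K : ℝ, 0 < D ∧ 0 < K ∧ ∀ g : ℕ → ℕ → ℝ, (∀ p a, 0 ≤ g p a) →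
      (∀ p, p.Prime → g p 1 ≤ 3) →
      (∀ p a, p.Prime → 2 ≤ a → g p a ≤ 3 * ((p : ℝ) ^ a) ^ (1 / 8 : ℝ)) →
      (∀ M : ℕ, ∑ q ∈ primePowerPairs M, g q.1 q.2 * (q.2 * log q.1) ≤ D * M) ∧
      ∀ N : ℕ, ∑ q ∈ primePowerPairs N, g q.1 q.2 / (q.1 : ℝ) ^ q.2 ≤
        ∑ p ∈ N.primesLE, g p 1 / p + K := by
  obtain ⟨K, hK, hKN⟩ := exists_sum_higher_primePowers_le
  refine ⟨3 * log 4 + 24 * K, 3 * K, ?_, by positivity, fun g hg0 hg1 hg2 => ⟨fun M => ?_,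
    fun N => ?_⟩⟩
  · have : 0 < log 4 := log_pos (by norm_num)
    positivity
  · rw [sum_primePowerPairs_eq]
    have h1 : ∑ p ∈ M.primesLE, g p 1 * ((1 : ℕ) * log p) ≤ 3 * log 4 * M := by
      have h2 : ∑ p ∈ M.primesLE, log p ≤ log 4 * M := by
        rw [← Chebyshev.theta_eq_sum_primesLE_log]
        exact Chebyshev.theta_le_log4_mul_x (Nat.cast_nonneg M)
      calc _ ≤ ∑ p ∈ M.primesLE, 3 * log p := by
            refine sum_le_sum fun p hp => ?_
            rw [Nat.cast_one, one_mul]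
            exact mul_le_mul_of_nonneg_right (hg1 p (Nat.mem_primesLE.1 hp).2)
              (log_natCast_nonneg p)
        _ = 3 * ∑ p ∈ M.primesLE, log p := by rw [mul_sum]
        _ ≤ _ := by linarith
    have h2 : ∑ q ∈ (primePowerPairs M).filter (fun q => 2 ≤ q.2), g q.1 q.2 * (q.2 * log q.1) ≤
        24 * K * M := by
      calc _ ≤ ∑ q ∈ (primePowerPairs M).filter (fun q => 2 ≤ q.2),
            (24 * M) * ((q.1 : ℝ) ^ q.2) ^ (-(3 / 4) : ℝ) := by
            refine sum_le_sum ?_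
            rintro ⟨p, a⟩ hq
            simp only [mem_filter, mem_primePowerPairs] at hq
            obtain ⟨⟨hp, -, hM⟩, ha⟩ := hq
            have hp0 : (0 : ℝ) < p := by exact_mod_cast hp.pos
            have hq0 : (0 : ℝ) < (p : ℝ) ^ a := by positivity
            have hqM : (p : ℝ) ^ a ≤ M := by exact_mod_cast hM
            have h3 : (a : ℝ) * log p ≤ 8 * ((p : ℝ) ^ a) ^ (1 / 8 : ℝ) := by
              rw [← log_pow]
              have := log_le_rpow_div hq0.le (ε := 1 / 8) (by norm_num)
              linarith
            have h4 : ((p : ℝ) ^ a) ^ (1 / 8 : ℝ) * ((p : ℝ) ^ a) ^ (1 / 8 : ℝ) =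
                (p : ℝ) ^ a * ((p : ℝ) ^ a) ^ (-(3 / 4) : ℝ) := by
              rw [← rpow_add hq0, ← rpow_one_add' hq0.le (by norm_num)]; norm_num
            calc g p a * ((a : ℝ) * log p)
                ≤ (3 * ((p : ℝ) ^ a) ^ (1 / 8 : ℝ)) * (8 * ((p : ℝ) ^ a) ^ (1 / 8 : ℝ)) :=
                  mul_le_mul (hg2 p a hp ha) h3
                    (mul_nonneg (Nat.cast_nonneg _) (log_natCast_nonneg _)) (by positivity)
              _ = 24 * ((p : ℝ) ^ a) * ((p : ℝ) ^ a) ^ (-(3 / 4) : ℝ) := by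
                  rw [mul_mul_mul_comm, h4]; ring
              _ ≤ _ := by gcongr
        _ = 24 * M * ∑ q ∈ (primePowerPairs M).filter (fun q => 2 ≤ q.2),
            ((q.1 : ℝ) ^ q.2) ^ (-(3 / 4) : ℝ) := by rw [mul_sum]
        _ ≤ 24 * M * K := by
            exact mul_le_mul_of_nonneg_left (hKN M) (by positivity)
        _ = _ := by ring
    calc _ ≤ 3 * log 4 * M + 24 * K * M := add_le_add h1 h2
      _ = _ := by ring
  · rw [sum_primePowerPairs_eq]
    refine add_le_add (le_of_eq (by simp)) ?_
    calc _ ≤ ∑ q ∈ (primePowerPairs N).filter (fun q => 2 ≤ q.2),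
          3 * ((q.1 : ℝ) ^ q.2) ^ (-(3 / 4) : ℝ) := by
          refine sum_le_sum ?_
          rintro ⟨p, a⟩ hq
          simp only [mem_filter, mem_primePowerPairs] at hq
          obtain ⟨⟨hp, -, -⟩, ha⟩ := hq
          have hp1 : (1 : ℝ) ≤ p := by exact_mod_cast hp.one_lt.le
          have hq1 : (1 : ℝ) ≤ (p : ℝ) ^ a := one_le_pow₀ hp1
          have hq0 : (0 : ℝ) < (p : ℝ) ^ a := by linarith
          simp only
          rw [div_le_iff₀ hq0]
          refine (hg2 p a hp ha).trans ?_
          rw [mul_assoc]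
          refine mul_le_mul_of_nonneg_left ?_ (by norm_num)
          rw [mul_comm, ← rpow_one_add' hq0.le (by norm_num)]
          exact rpow_le_rpow_of_exponent_le hq1 (by norm_num)
      _ = 3 * ∑ q ∈ (primePowerPairs N).filter (fun q => 2 ≤ q.2),
          ((q.1 : ℝ) ^ q.2) ^ (-(3 / 4) : ℝ) := by rw [mul_sum]
      _ ≤ 3 * K := mul_le_mul_of_nonneg_left (hKN N) (by norm_num)

/-- Double counting the pairs `p ∈ U` over the `(j + 1)`-element subsets `U` of `s`. -/
theorem sum_powersetCard_succ_mul_sum (s : Finset ℕ) (f w : ℕ → ℝ) (j : ℕ) :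
    ∑ U ∈ powersetCard (j + 1) s, (∏ p ∈ U, f p) * ∑ p ∈ U, w p =
      ∑ V ∈ powersetCard j s, (∏ p ∈ V, f p) * ∑ p ∈ s \ V, f p * w p := by
  simp only [mul_sum]
  rw [sum_sigma', sum_sigma']
  refine sum_bij' (fun t _ => ⟨t.1.erase t.2, t.2⟩) (fun t _ => ⟨insert t.2 t.1, t.2⟩) ?_ ?_ ?_ ?_ ?_
  · rintro ⟨U, p⟩ h
    simp only [mem_sigma, mem_powersetCard, mem_sdiff] at h ⊢
    obtain ⟨⟨hU, hc⟩, hp⟩ := h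
    refine ⟨⟨(erase_subset _ _).trans hU, ?_⟩, hU hp, notMem_erase _ _⟩
    rw [card_erase_of_mem hp, hc]; rfl
  · rintro ⟨V, p⟩ h
    simp only [mem_sigma, mem_powersetCard, mem_sdiff] at h ⊢
    obtain ⟨⟨hV, hc⟩, hp, hpV⟩ := h
    refine ⟨⟨insert_subset hp hV, ?_⟩, mem_insert_self _ _⟩
    rw [card_insert_of_notMem hpV, hc]
  · rintro ⟨U, p⟩ h
    simp only [mem_sigma] at h
    simp [insert_erase h.2]
  · rintro ⟨V, p⟩ h
    simp only [mem_sigma, mem_sdiff] at h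
    simp [erase_insert h.2.2]
  · rintro ⟨U, p⟩ h
    simp only [mem_sigma] at h
    rw [← mul_prod_erase U f h.2]
    ring

theorem sum_powersetCard_succ_mul_sum_le {s : Finset ℕ} {f w : ℕ → ℝ} (hf : ∀ p, 0 ≤ f p)
    (hw : ∀ p, 0 ≤ w p) (j : ℕ) :
    ∑ U ∈ powersetCard (j + 1) s, (∏ p ∈ U, f p) * ∑ p ∈ U, w p ≤
      (∑ V ∈ powersetCard j s, ∏ p ∈ V, f p) * ∑ p ∈ s, f p * w p := by
  rw [sum_powersetCard_succ_mul_sum, sum_mul]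
  refine sum_le_sum fun V _ => mul_le_mul_of_nonneg_left ?_ (prod_nonneg fun p _ => hf p)
  exact sum_le_sum_of_subset_of_nonneg sdiff_subset fun p _ _ => mul_nonneg (hf p) (hw p)

theorem factorial_mul_sum_powersetCard_le {s : Finset ℕ} {f : ℕ → ℝ} (hf : ∀ p, 0 ≤ f p) (j : ℕ) :
    j.factorial * ∑ U ∈ powersetCard j s, ∏ p ∈ U, f p ≤ (∑ p ∈ s, f p) ^ j := by
  induction j with
  | zero => simp
  | succ j ih =>
    have h1 := sum_powersetCard_succ_mul_sum_le (s := s) hf (w := fun _ => 1)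
      (fun _ => zero_le_one) j
    have h2 : ∑ U ∈ powersetCard (j + 1) s, (∏ p ∈ U, f p) * ∑ p ∈ U, (1 : ℝ) =
        ((j : ℝ) + 1) * ∑ U ∈ powersetCard (j + 1) s, ∏ p ∈ U, f p := by
      rw [mul_sum]
      refine sum_congr rfl fun U hU => ?_
      rw [sum_const, (mem_powersetCard.1 hU).2]
      simp [mul_comm]
    simp only [mul_one] at h1
    rw [h2] at h1
    have h3 : 0 ≤ ∑ p ∈ s, f p := sum_nonneg fun p _ => hf p
    rw [Nat.factorial_succ, pow_succ]
    push_cast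
    calc _ = (j.factorial : ℝ) * (((j : ℝ) + 1) * ∑ U ∈ powersetCard (j + 1) s, ∏ p ∈ U, f p) := by
          ring
      _ ≤ (j.factorial : ℝ) * ((∑ V ∈ powersetCard j s, ∏ p ∈ V, f p) * ∑ p ∈ s, f p) :=
          mul_le_mul_of_nonneg_left h1 (by positivity)
      _ ≤ _ := by
          rw [← mul_assoc]
          exact mul_le_mul_of_nonneg_right ih h3

theorem le_factorial_mul_sum_powersetCard {s : Finset ℕ} {f : ℕ → ℝ} (hf : ∀ p, 0 ≤ f p)
    (hS : 0 < ∑ p ∈ s, f p) (j : ℕ) :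
    (∑ p ∈ s, f p) ^ j * (1 - (∑ p ∈ s, f p * f p) * j ^ 2 / (∑ p ∈ s, f p) ^ 2) ≤
      j.factorial * ∑ U ∈ powersetCard j s, ∏ p ∈ U, f p := by
  set S := ∑ p ∈ s, f p with hSdef
  set σ := ∑ p ∈ s, f p * f p with hσ
  have hσ0 : 0 ≤ σ := sum_nonneg fun p _ => mul_nonneg (hf p) (hf p)
  have hrec : ∀ j : ℕ, ((j : ℝ) + 1) * ∑ U ∈ powersetCard (j + 1) s, ∏ p ∈ U, f p =
      S * ∑ U ∈ powersetCard j s, ∏ p ∈ U, f p -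
        ∑ U ∈ powersetCard j s, (∏ p ∈ U, f p) * ∑ p ∈ U, f p := by
    intro j
    have h2 : ∑ U ∈ powersetCard (j + 1) s, (∏ p ∈ U, f p) * ∑ p ∈ U, (1 : ℝ) =
        ((j : ℝ) + 1) * ∑ U ∈ powersetCard (j + 1) s, ∏ p ∈ U, f p := by
      rw [mul_sum]
      refine sum_congr rfl fun U hU => ?_
      rw [sum_const, (mem_powersetCard.1 hU).2]
      simp [mul_comm]
    rw [← h2, sum_powersetCard_succ_mul_sum s f (fun _ => 1) j, mul_sum, ← sum_sub_distrib]
    refine sum_congr rfl fun V hV => ?_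
    simp only [mul_one]
    have := sum_sdiff (f := f) (mem_powersetCard.1 hV).1
    have h3 : ∑ p ∈ s \ V, f p = S - ∑ p ∈ V, f p := by rw [hSdef]; linarith
    rw [h3]; ring
  induction j with
  | zero => simp
  | succ j ih =>
    have h1 : j.factorial * ∑ U ∈ powersetCard j s, (∏ p ∈ U, f p) * ∑ p ∈ U, f p ≤
        S ^ (j + 1) * (σ * j / S ^ 2) := by
      cases j with
      | zero => simp
      | succ i =>
        have h2 := sum_powersetCard_succ_mul_sum_le (s := s) hf hf i
        have h3 := factorial_mul_sum_powersetCard_le (s := s) hf i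
        calc _ ≤ ((i + 1).factorial : ℝ) * ((∑ V ∈ powersetCard i s, ∏ p ∈ V, f p) * σ) :=
              mul_le_mul_of_nonneg_left h2 (by positivity)
          _ = ((i : ℝ) + 1) * σ * (i.factorial * ∑ V ∈ powersetCard i s, ∏ p ∈ V, f p) := by
              rw [Nat.factorial_succ]; push_cast; ring
          _ ≤ ((i : ℝ) + 1) * σ * S ^ i := mul_le_mul_of_nonneg_left h3 (by positivity)
          _ = _ := by push_cast; field_simp; ring
    have h4 : ((j + 1).factorial : ℝ) * ∑ U ∈ powersetCard (j + 1) s, ∏ p ∈ U, f p =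
        S * (j.factorial * ∑ U ∈ powersetCard j s, ∏ p ∈ U, f p) -
        j.factorial * ∑ U ∈ powersetCard j s, (∏ p ∈ U, f p) * ∑ p ∈ U, f p := by
      rw [Nat.factorial_succ]
      push_cast
      have := hrec j
      linear_combination (j.factorial : ℝ) * this
    rw [h4]
    have h5 := mul_le_mul_of_nonneg_left ih hS.le
    have h6 : S ^ (j + 1) * (1 - σ * ((j + 1 : ℕ) : ℝ) ^ 2 / S ^ 2) ≤
        S * (S ^ j * (1 - σ * j ^ 2 / S ^ 2)) - S ^ (j + 1) * (σ * j / S ^ 2) := by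
      have h7 : S * (S ^ j * (1 - σ * j ^ 2 / S ^ 2)) - S ^ (j + 1) * (σ * j / S ^ 2) -
          S ^ (j + 1) * (1 - σ * ((j + 1 : ℕ) : ℝ) ^ 2 / S ^ 2) =
          S ^ (j + 1) * (σ * (j + 1) / S ^ 2) := by push_cast; ring
      have h8 : 0 ≤ S ^ (j + 1) * (σ * (j + 1) / S ^ 2) := by positivity
      linarith
    linarith

/-- Each set `U` of primes at most `Y` with `#U = j`, together with a prime `Y < p ≤ N / ∏ U`,
gives a distinct integer with exactly `j + 1` prime factors. -/
theorem sum_card_primes_le_card_omega {s : Finset ℕ} {Y : ℕ} (hs : ∀ p ∈ s, p.Prime ∧ p ≤ Y)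
    (j N : ℕ) {Q : Finset (Finset ℕ)} (hQ : Q ⊆ powersetCard j s) :
    ∑ U ∈ Q, #{p ∈ (N / ∏ p ∈ U, p).primesLE | Y < p} ≤
      #{n ∈ Finset.Icc 1 N | n.primeFactors.card = j + 1} := by
  rw [← card_sigma]
  have hsU : ∀ U ∈ Q, ∀ p ∈ U, p.Prime ∧ p ≤ Y := fun U hU p hp =>
    hs p ((mem_powersetCard.1 (hQ hU)).1 hp)
  have hpf : ∀ U ∈ Q, ∀ p : ℕ, p.Prime → (p * ∏ q ∈ U, q).primeFactors = insert p U := by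
    intro U hU p hp
    have h0 : ∏ q ∈ U, q ≠ 0 := prod_ne_zero_iff.2 fun q hq => (hsU U hU q hq).1.ne_zero
    rw [Nat.primeFactors_mul hp.ne_zero h0, hp.primeFactors,
      Nat.primeFactors_prod fun q hq => (hsU U hU q hq).1]
    rfl
  refine card_le_card_of_injOn (fun t => t.2 * ∏ q ∈ t.1, q) ?_ ?_
  · rintro ⟨U, p⟩ h
    simp only [coe_sigma, Set.mem_sigma_iff, mem_coe, mem_filter, Nat.mem_primesLE] at h
    obtain ⟨hU, ⟨hpN, hp⟩, hY⟩ := h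
    have h0 : 0 < ∏ q ∈ U, q := prod_pos fun q hq => (hsU U hU q hq).1.pos
    simp only [coe_filter, Set.mem_ofPred_eq, Finset.mem_Icc]
    refine ⟨⟨Nat.mul_pos hp.pos h0, (Nat.le_div_iff_mul_le h0).1 hpN⟩, ?_⟩
    rw [hpf U hU p hp, card_insert_of_notMem, (mem_powersetCard.1 (hQ hU)).2]
    exact fun hpU => absurd (hsU U hU p hpU).2 (by omega)
  · rintro ⟨U, p⟩ h ⟨U', p'⟩ h' heq
    simp only [coe_sigma, Set.mem_sigma_iff, mem_coe, mem_filter, Nat.mem_primesLE] at h h' heq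
    obtain ⟨hU, ⟨hpN, hp⟩, hY⟩ := h
    obtain ⟨hU', ⟨hpN', hp'⟩, hY'⟩ := h'
    have h1 : insert p U = insert p' U' := by
      rw [← hpf U hU p hp, ← hpf U' hU' p' hp', heq]
    have h2 : ∀ V ∈ Q, ∀ q, Y < q → (insert q V).filter (· ≤ Y) = V := by
      intro V hV q hq
      rw [filter_insert, if_neg (by omega)]
      exact filter_true_of_mem fun r hr => (hsU V hV r hr).2
    have h3 : U = U' := by rw [← h2 U hU p hY, h1, h2 U' hU' p' hY']
    subst h3
    have h0 : 0 < ∏ q ∈ U, q := prod_pos fun q hq => (hsU U hU q hq).1.pos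
    have := Nat.eq_of_mul_eq_mul_right h0 heq
    rw [this]

section

open Filter

theorem eventually_rpow_mul_log_rpow_le {a b c : ℝ} (hab : a < b) (K : ℝ) :
    ∀ᶠ x : ℝ in atTop, K * (x ^ a * (log x) ^ c) ≤ x ^ b := by
  have h := (isLittleO_log_rpow_rpow_atTop c (sub_pos.2 hab)).def
    (show (0 : ℝ) < 1 / (|K| + 1) by positivity)
  filter_upwards [h, eventually_gt_atTop 1] with x hx h1
  have hx0 : 0 < x := by linarith
  have hl : 0 < log x := log_pos h1
  rw [norm_of_nonneg (by positivity), norm_of_nonneg (by positivity)] at hx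
  have h2 : (|K| + 1) * (log x) ^ c ≤ x ^ (b - a) := by
    have h3 : (0 : ℝ) < |K| + 1 := by positivity
    calc _ ≤ (|K| + 1) * (1 / (|K| + 1) * x ^ (b - a)) := mul_le_mul_of_nonneg_left hx h3.le
      _ = _ := by field_simp
  calc K * (x ^ a * (log x) ^ c) ≤ (|K| + 1) * (x ^ a * (log x) ^ c) := by
        refine mul_le_mul_of_nonneg_right ?_ (by positivity)
        linarith [le_abs_self K]
    _ = x ^ a * ((|K| + 1) * (log x) ^ c) := by ring
    _ ≤ x ^ a * x ^ (b - a) := mul_le_mul_of_nonneg_left h2 (by positivity)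
    _ = x ^ b := by rw [← rpow_add hx0]; ring_nf

theorem eventually_le_card_primesLE_gt :
    ∀ᶠ x : ℝ in atTop, ∀ m : ℕ, 1 ≤ m → (m : ℝ) ≤ x ^ (1 / 3 : ℝ) →
      x / (4 * log x) * (1 / m) ≤ #{p ∈ (⌊x⌋₊ / m).primesLE | ⌊√x⌋₊ < p} := by
  have h1 : ∀ᶠ t : ℝ in atTop, 100 * (t ^ (0 : ℝ) * (log t) ^ (1 : ℝ)) ≤ t ^ (1 : ℝ) :=
    eventually_rpow_mul_log_rpow_le (by norm_num) 100
  obtain ⟨T, hT⟩ := eventually_atTop.1 h1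
  have h2 : ∀ᶠ x : ℝ in atTop, max T 100 ≤ x ^ (2 / 3 : ℝ) :=
    (tendsto_rpow_atTop (by norm_num)).eventually_ge_atTop _
  have h3 : ∀ᶠ x : ℝ in atTop, 4 * (x ^ (1 / 2 : ℝ) * (log x) ^ (1 : ℝ)) ≤ x ^ (2 / 3 : ℝ) :=
    eventually_rpow_mul_log_rpow_le (by norm_num) 4
  filter_upwards [h2, h3, eventually_gt_atTop 1] with x hx2 hx3 hx1 m hm1 hm
  have hx0 : 0 < x := by linarith
  have hl : 0 < log x := log_pos hx1
  have hm0 : (0 : ℝ) < m := by exact_mod_cast hm1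
  have hm1' : (1 : ℝ) ≤ m := by exact_mod_cast hm1
  rw [rpow_one, ← sqrt_eq_rpow] at hx3
  set t := x / m with ht
  have htx : t ≤ x := div_le_self hx0.le hm1'
  have htl : x ^ (2 / 3 : ℝ) ≤ t := by
    rw [ht, le_div_iff₀ hm0]
    calc _ ≤ x ^ (2 / 3 : ℝ) * x ^ (1 / 3 : ℝ) := mul_le_mul_of_nonneg_left hm (by positivity)
      _ = x := by rw [← rpow_add hx0]; norm_num
  have htT : T ≤ t := (le_max_left _ _).trans (hx2.trans htl)
  have ht100 : 100 ≤ t := (le_max_right _ _).trans (hx2.trans htl)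
  have hlt : 0 < log t := log_pos (by linarith)
  have hltx : log t ≤ log x := log_le_log (by linarith) htx
  have hpi := Chebyshev.pi_ge' (x := t) (by linarith)
  have hTt := hT t htT
  rw [rpow_zero, rpow_one, rpow_one, one_mul] at hTt
  have hnum : t / 2 ≤ (t - 1) * log 2 - log (t + 2) := by
    have h5 : log (t + 2) ≤ log t + 2 / t := by
      have : log (t + 2) - log t ≤ (t + 2) / t - 1 := by
        rw [← log_div (by linarith) (by linarith)]
        exact log_le_sub_one_of_pos (by positivity)
      have h6 : (t + 2) / t - 1 = 2 / t := by field_simp; ring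
      linarith
    have h7 : 2 / t ≤ 1 := by rw [div_le_one (by linarith)]; linarith
    have h8 := log_two_gt_d9
    nlinarith
  have hpi2 : t / (2 * log x) ≤ (⌊t⌋₊.primeCounting : ℝ) := by
    refine le_trans ?_ hpi
    calc t / (2 * log x) = (t / 2) / log x := by field_simp
      _ ≤ (t / 2) / log t := div_le_div_of_nonneg_left (by linarith) hlt hltx
      _ ≤ _ := div_le_div_of_nonneg_right hnum hlt.le
  have hcard : (⌊t⌋₊.primeCounting : ℝ) ≤
      #{p ∈ (⌊x⌋₊ / m).primesLE | ⌊√x⌋₊ < p} + √x := by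
    rw [← Nat.primesLE_card_eq_primeCounting, ht, Nat.floor_div_natCast]
    have h6 := card_filter_add_card_filter_not (s := (⌊x⌋₊ / m).primesLE) (fun p => ⌊√x⌋₊ < p)
    have h7 : #{p ∈ (⌊x⌋₊ / m).primesLE | ¬ ⌊√x⌋₊ < p} ≤ ⌊√x⌋₊ := by
      have : {p ∈ (⌊x⌋₊ / m).primesLE | ¬ ⌊√x⌋₊ < p} ⊆ Finset.Icc 1 ⌊√x⌋₊ := by
        intro p hp
        simp only [mem_filter, Nat.mem_primesLE, not_lt] at hp
        exact Finset.mem_Icc.2 ⟨hp.1.2.one_lt.le, hp.2⟩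
      simpa using card_le_card this
    have h8 : (⌊√x⌋₊ : ℝ) ≤ √x := Nat.floor_le (sqrt_nonneg x)
    have h9 : ((#{p ∈ (⌊x⌋₊ / m).primesLE | ¬ ⌊√x⌋₊ < p} : ℕ) : ℝ) ≤ ⌊√x⌋₊ := by
      exact_mod_cast h7
    rw [← h6]
    push_cast
    linarith
  have hsq : √x ≤ t / (4 * log x) := by
    rw [le_div_iff₀ (by positivity)]
    linarith
  have e1 : x / (4 * log x) * (1 / m) = t / (4 * log x) := by rw [ht]; field_simp
  have e2 : t / (2 * log x) = 2 * (t / (4 * log x)) := by field_simp; ring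
  rw [e1]
  linarith

/-- A Markov-type bound: if `∑ log p / p` is small compared with `T`, most of the mass of the
elementary symmetric function of `1 / p` lives on sets with product at most `exp T`. -/
theorem half_pow_le_factorial_mul_sum_filter {s : Finset ℕ} (hs : ∀ p ∈ s, p.Prime) {j : ℕ}
    {b T : ℝ} (hT : 0 < T) (hS : 0 < ∑ p ∈ s, 1 / (p : ℝ))
    (hσ : 4 * ((∑ p ∈ s, 1 / (p : ℝ) * (1 / (p : ℝ))) * (j : ℝ) ^ 2) ≤
      (∑ p ∈ s, 1 / (p : ℝ)) ^ 2)
    (hb : ∑ p ∈ s, 1 / (p : ℝ) * log p ≤ b) (hbj : 4 * (b * j) ≤ T * ∑ p ∈ s, 1 / (p : ℝ)) :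
    (∑ p ∈ s, 1 / (p : ℝ)) ^ j / 2 ≤ j.factorial *
      ∑ U ∈ powersetCard j s with ((∏ p ∈ U, p : ℕ) : ℝ) ≤ exp T, ∏ p ∈ U, 1 / (p : ℝ) := by
  set S := ∑ p ∈ s, 1 / (p : ℝ) with hSdef
  have hf : ∀ p : ℕ, (0 : ℝ) ≤ 1 / (p : ℝ) := fun p => by positivity
  have hw : ∀ p : ℕ, (0 : ℝ) ≤ log p := fun p => log_natCast_nonneg p
  have hlow := le_factorial_mul_sum_powersetCard hf hS j
  rw [← hSdef] at hlow
  have hlow' : 3 / 4 * S ^ j ≤ j.factorial * ∑ U ∈ powersetCard j s, ∏ p ∈ U, 1 / (p : ℝ) := by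
    refine le_trans ?_ hlow
    have h1 : (∑ p ∈ s, 1 / (p : ℝ) * (1 / (p : ℝ))) * (j : ℝ) ^ 2 / S ^ 2 ≤ 1 / 4 := by
      rw [div_le_iff₀ (by positivity)]; linarith
    have h2 : 0 ≤ S ^ j := by positivity
    nlinarith
  have hcompl : j.factorial * ∑ U ∈ powersetCard j s with ¬ ((∏ p ∈ U, p : ℕ) : ℝ) ≤ exp T,
      ∏ p ∈ U, 1 / (p : ℝ) ≤ S ^ j / 4 := by
    rcases j with _ | i
    · rw [filter_false_of_mem]
      · simp
      · intro U hU
        simp only [powersetCard_zero, mem_singleton] at hU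
        subst hU
        simp [hT.le]
    · have h1 : T * ∑ U ∈ powersetCard (i + 1) s with ¬ ((∏ p ∈ U, p : ℕ) : ℝ) ≤ exp T,
          ∏ p ∈ U, 1 / (p : ℝ) ≤
          ∑ U ∈ powersetCard (i + 1) s, (∏ p ∈ U, 1 / (p : ℝ)) * ∑ p ∈ U, log p := by
        rw [mul_sum]
        refine le_trans (sum_le_sum fun U hU => ?_) (sum_le_sum_of_subset_of_nonneg
          (filter_subset (fun U => ¬ ((∏ p ∈ U, p : ℕ) : ℝ) ≤ exp T) _) fun U _ _ => ?_)
        · rw [mem_filter, mem_powersetCard] at hU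
          have h2 : T ≤ ∑ p ∈ U, log p := by
            rw [← log_prod fun p hp => by
              have := (hs p (hU.1.1 hp)).pos
              positivity]
            have h3 := hU.2
            push_cast at h3
            exact ((lt_log_iff_exp_lt (lt_trans (exp_pos _) (not_le.1 h3))).2 (not_le.1 h3)).le
          rw [mul_comm]
          exact mul_le_mul_of_nonneg_left h2 (prod_nonneg fun p _ => hf p)
        · exact mul_nonneg (prod_nonneg fun p _ => hf p) (sum_nonneg fun p _ => hw p)
      have h2 := sum_powersetCard_succ_mul_sum_le (s := s) hf hw i
      have h3 := factorial_mul_sum_powersetCard_le (s := s) hf i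
      rw [← hSdef] at h3
      set A := ∑ U ∈ powersetCard (i + 1) s with ¬ ((∏ p ∈ U, p : ℕ) : ℝ) ≤ exp T,
        ∏ p ∈ U, 1 / (p : ℝ)
      set E := ∑ V ∈ powersetCard i s, ∏ p ∈ V, 1 / (p : ℝ)
      have hE : 0 ≤ E := sum_nonneg fun V _ => prod_nonneg fun p _ => hf p
      have h4 : T * A ≤ E * b := h1.trans (h2.trans (mul_le_mul_of_nonneg_left hb hE))
      have hb0 : 0 ≤ b := le_trans (sum_nonneg fun p _ => mul_nonneg (hf p) (hw p)) hb
      refine le_of_mul_le_mul_left ?_ hT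
      calc T * ((i + 1).factorial * A) = (i + 1).factorial * (T * A) := by ring
        _ ≤ (i + 1).factorial * (E * b) := mul_le_mul_of_nonneg_left h4 (by positivity)
        _ = (b * ((i + 1 : ℕ) : ℝ)) * (i.factorial * E) := by
            rw [Nat.factorial_succ]; push_cast; ring
        _ ≤ (b * ((i + 1 : ℕ) : ℝ)) * S ^ i := mul_le_mul_of_nonneg_left h3 (by positivity)
        _ ≤ (T * S / 4) * S ^ i := mul_le_mul_of_nonneg_right (by linarith) (by positivity)
        _ = T * (S ^ (i + 1) / 4) := by ring
  have hsplit := sum_filter_add_sum_filter_not (powersetCard j s)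
    (fun U => ((∏ p ∈ U, p : ℕ) : ℝ) ≤ exp T) (fun U => ∏ p ∈ U, 1 / (p : ℝ))
  rw [← hsplit, mul_add] at hlow'
  linarith

theorem exists_primes_of_sum_sq_inv_le {δ σ : ℝ} (hδ : 0 < δ) (hδ2 : δ ≤ 1 / 2) (hσ : 0 < σ) :
    ∃ C : ℝ, 0 < C ∧ ∀ᶠ x : ℝ in atTop, ∃ s : Finset ℕ, (∀ p ∈ s, p.Prime ∧ p ≤ ⌊√x⌋₊) ∧
      log (log x) - C ≤ ∑ p ∈ s, 1 / (p : ℝ) ∧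
      ∑ p ∈ s, 1 / (p : ℝ) * (1 / (p : ℝ)) ≤ σ ∧
      ∑ p ∈ s, 1 / (p : ℝ) * log p ≤ 2 * δ * log x := by
  have hsum : Summable fun n : ℕ => 1 / (n : ℝ) * (1 / (n : ℝ)) := by
    have := Real.summable_one_div_nat_pow.2 (show 1 < 2 by norm_num)
    refine this.congr fun n => ?_
    rw [div_mul_div_comm, one_mul, sq]
  obtain ⟨w, hw⟩ := summable_iff_vanishing_norm.1 hsum σ hσ
  obtain ⟨C, hC, hM⟩ := exists_abs_sum_primes_inv_sub_le
  have hW : (0 : ℝ) ≤ ∑ p ∈ w, 1 / (p : ℝ) := sum_nonneg fun p _ => by positivity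
  have hd : 0 ≤ log (1 / δ) := log_nonneg (by rw [le_div_iff₀ hδ]; linarith)
  refine ⟨C + (∑ p ∈ w, 1 / (p : ℝ)) + log (1 / δ), by positivity, ?_⟩
  have hy : Tendsto (fun x : ℝ => x ^ δ) atTop atTop := tendsto_rpow_atTop hδ
  filter_upwards [hy.eventually_ge_atTop 4, eventually_ge_atTop 3] with x hx4 hx3
  have hlx : 0 < log x := log_pos (by linarith)
  have hly : log (x ^ δ) = δ * log x := log_rpow (by linarith) δ
  refine ⟨(⌊x ^ δ⌋₊).primesLE \ w, fun p hp => ?_, ?_, ?_, ?_⟩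
  · rw [Finset.mem_sdiff, Nat.mem_primesLE] at hp
    refine ⟨hp.1.2, hp.1.1.trans (Nat.floor_le_floor ?_)⟩
    rw [sqrt_eq_rpow]
    exact rpow_le_rpow_of_exponent_le (by linarith) hδ2
  · have h1 := (abs_le.1 (hM (x ^ δ) (by linarith))).1
    have h2 : ∑ p ∈ (⌊x ^ δ⌋₊).primesLE, 1 / (p : ℝ) ≤
        ∑ p ∈ (⌊x ^ δ⌋₊).primesLE \ w, 1 / (p : ℝ) + ∑ p ∈ w, 1 / (p : ℝ) := by
      rw [← sum_inter_add_sum_sdiff _ w, add_comm]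
      gcongr
      exact inter_subset_right
    rw [hly, log_mul hδ.ne' hlx.ne'] at h1
    rw [one_div, log_inv]
    linarith
  · have := hw ((⌊x ^ δ⌋₊).primesLE \ w) (sdiff_disjoint)
    exact ((le_abs_self _).trans this.le)
  · have h1 := sum_primes_log_div_le ⌊x ^ δ⌋₊ (Nat.le_floor (by norm_num; linarith))
    have h2 : log (⌊x ^ δ⌋₊ : ℝ) ≤ log (x ^ δ) := by
      refine log_le_log ?_ (Nat.floor_le (by positivity))
      exact_mod_cast Nat.floor_pos.2 (by linarith)
    have h3 : log 4 ≤ log (x ^ δ) := log_le_log (by norm_num) hx4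
    calc _ ≤ ∑ p ∈ (⌊x ^ δ⌋₊).primesLE, 1 / (p : ℝ) * log p :=
          sum_le_sum_of_subset_of_nonneg sdiff_subset fun p _ _ =>
            mul_nonneg (by positivity) (log_natCast_nonneg p)
      _ = ∑ p ∈ (⌊x ^ δ⌋₊).primesLE, log p / p := sum_congr rfl fun p _ => by ring
      _ ≤ _ := by linarith

theorem exists_le_pik {R : ℝ} (hR : 1 ≤ R) : ∃ c : ℝ, 0 < c ∧ ∀ᶠ x : ℝ in atTop, ∀ j : ℕ,
    (j : ℝ) ≤ R * log (log x) →
      c * (x / log x * (log (log x) ^ j / j.factorial)) ≤ pik (j + 1) x := by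
  obtain ⟨C, hC, hs⟩ := exists_primes_of_sum_sq_inv_le (δ := 1 / (48 * R)) (σ := 1 / (16 * R ^ 2))
    (by positivity) (by
      apply one_div_le_one_div_of_le (by norm_num)
      linarith) (by positivity)
  have hLL : Tendsto (fun x : ℝ => log (log x)) atTop atTop :=
    tendsto_log_atTop.comp tendsto_log_atTop
  refine ⟨exp (-(2 * C * R)) / 8, by positivity, ?_⟩
  filter_upwards [hs, eventually_le_card_primesLE_gt, hLL.eventually_ge_atTop (2 * C),
    eventually_ge_atTop 3] with x ⟨s, hsp, hsS, hsσ, hsb⟩ hcard hL hx3 j hj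
  set L := log (log x)
  set S := ∑ p ∈ s, 1 / (p : ℝ)
  have hx0 : 0 < x := by linarith
  have hlx : 0 < log x := log_pos (by linarith)
  have hL0 : 0 < L := by linarith
  have hSL : L / 2 ≤ S := by linarith
  have hS : 0 < S := by linarith
  have hR0 : 0 < R := by linarith
  have hjS : (j : ℝ) ≤ R * (2 * S) := hj.trans (mul_le_mul_of_nonneg_left (by linarith) hR0.le)
  have hmain := half_pow_le_factorial_mul_sum_filter (fun p hp => (hsp p hp).1) (j := j)
    (b := 2 * (1 / (48 * R)) * log x) (T := log x / 3) (by positivity) hS (by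
      have h1 : (j : ℝ) ^ 2 ≤ (R * (2 * S)) ^ 2 := by gcongr
      calc _ ≤ 4 * (1 / (16 * R ^ 2) * (R * (2 * S)) ^ 2) := by gcongr
        _ = S ^ 2 := by field_simp; ring) hsb (by
      calc _ ≤ 4 * (2 * (1 / (48 * R)) * log x * (R * (2 * S))) := by gcongr
        _ = log x / 3 * S := by field_simp; ring)
  have hexp : exp (log x / 3) = x ^ (1 / 3 : ℝ) := by
    rw [rpow_def_of_pos hx0]; ring_nf
  rw [hexp] at hmain
  set Q := (powersetCard j s).filter fun U => ((∏ p ∈ U, p : ℕ) : ℝ) ≤ x ^ (1 / 3 : ℝ)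
  have hcount := sum_card_primes_le_card_omega hsp j ⌊x⌋₊ (Q := Q) (filter_subset _ _)
  have h1 : x / (4 * log x) * ∑ U ∈ Q, ∏ p ∈ U, 1 / (p : ℝ) ≤ pik (j + 1) x := by
    rw [mul_sum]
    refine le_trans (sum_le_sum fun U hU => ?_) (show
      ∑ U ∈ Q, (#{p ∈ (⌊x⌋₊ / ∏ p ∈ U, p).primesLE | ⌊√x⌋₊ < p} : ℝ) ≤ pik (j + 1) x by
        unfold pik
        exact_mod_cast hcount)
    rw [mem_filter, mem_powersetCard] at hU
    refine le_trans (le_of_eq ?_) (hcard (∏ p ∈ U, p)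
      (Nat.one_le_iff_ne_zero.2 (prod_ne_zero_iff.2 fun p hp =>
        (hsp p (hU.1.1 hp)).1.ne_zero)) hU.2)
    rw [prod_div_distrib]
    push_cast
    simp
  have h2 : exp (-(2 * C * R)) * L ^ j ≤ S ^ j := by
    have hu : exp (-(2 * (C / L))) ≤ 1 - C / L := by
      have hu0 : 0 ≤ C / L := by positivity
      have hu1 : C / L ≤ 1 / 2 := by rw [div_le_iff₀ hL0]; linarith
      have h3 := add_one_le_exp (2 * (C / L))
      rw [exp_neg]
      refine inv_le_of_inv_le₀ (by linarith) (le_trans ?_ h3)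
      rw [inv_le_iff_one_le_mul₀ (by linarith)]
      nlinarith
    calc exp (-(2 * C * R)) * L ^ j ≤ exp (-(2 * (C / L))) ^ j * L ^ j := by
          refine mul_le_mul_of_nonneg_right ?_ (by positivity)
          rw [← exp_nat_mul]
          refine exp_le_exp.2 ?_
          have : (j : ℝ) * (C / L) ≤ R * L * (C / L) := by gcongr
          have h4 : R * L * (C / L) = R * C := by field_simp
          linarith
      _ ≤ (1 - C / L) ^ j * L ^ j := by gcongr
      _ = (L - C) ^ j := by rw [← mul_pow]; congr 1; field_simp
      _ ≤ S ^ j := pow_le_pow_left₀ (by linarith) hsS j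
  refine le_trans ?_ h1
  have hfac : (0 : ℝ) < j.factorial := by positivity
  have h5 : exp (-(2 * C * R)) * L ^ j / 2 / j.factorial ≤
      ∑ U ∈ Q, ∏ p ∈ U, 1 / (p : ℝ) := by
    rw [div_le_iff₀ hfac]
    linarith
  calc _ = x / (4 * log x) * (exp (-(2 * C * R)) * L ^ j / 2 / j.factorial) := by
        field_simp; norm_num
    _ ≤ _ := mul_le_mul_of_nonneg_left h5 (by positivity)

theorem card_mul_le_of_le_factorization_prod {g : ℕ → ℕ → ℝ} (hg : ∀ p a, 0 ≤ g p a) {k : ℕ}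
    {x D u W : ℝ} (hx : 3 ≤ x) (hD : 0 ≤ D) (hu : 0 ≤ u) (hW : 0 ≤ W)
    (h : ∀ M : ℕ, ∑ q ∈ primePowerPairs M, g q.1 q.2 * (q.2 * log q.1) ≤ D * M)
    (hT : ∑ q ∈ primePowerPairs ⌊x⌋₊, g q.1 q.2 / (q.1 : ℝ) ^ q.2 ≤ log (log x) + u)
    (hL : 0 < log (log x)) {E : Finset ℕ}
    (hE : ∀ n ∈ E, n ∈ natsWithOmega (k + 1) ⌊x⌋₊ ∧ √x < n ∧ W ≤ n.factorization.prod g) :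
    (#E : ℝ) * W ≤
      2 * D * (x / log x * (log (log x) ^ k / k.factorial)) * exp (u * (k / log (log x))) := by
  set L := log (log x)
  have hx0 : 0 < x := by linarith
  have hlx : 0 < log x := log_pos (by linarith)
  have hmain := sum_weight_mul_log_le hg k ⌊x⌋₊ hD h
  have h1 : (#E : ℝ) * (W * (log x / 2)) ≤
      ∑ n ∈ natsWithOmega (k + 1) ⌊x⌋₊, n.factorization.prod g * log n := by
    rw [← nsmul_eq_mul, ← sum_const]
    refine le_trans (sum_le_sum fun n hn => ?_) (sum_le_sum_of_subset_of_nonneg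
      (fun n hn => (hE n hn).1) fun n _ _ => mul_nonneg
        (prod_nonneg fun p _ => hg _ _) (log_natCast_nonneg n))
    obtain ⟨-, h2, h3⟩ := hE n hn
    refine mul_le_mul h3 ?_ (by positivity) (hW.trans h3)
    rw [← log_sqrt hx0.le]
    exact log_le_log (by positivity) h2.le
  have hT0 : 0 ≤ ∑ q ∈ primePowerPairs ⌊x⌋₊, g q.1 q.2 / (q.1 : ℝ) ^ q.2 :=
    sum_nonneg fun q _ => div_nonneg (hg _ _) (by positivity)
  have h2 : (∑ q ∈ primePowerPairs ⌊x⌋₊, g q.1 q.2 / (q.1 : ℝ) ^ q.2) ^ k ≤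
      L ^ k * exp (u * (k / L)) := by
    calc _ ≤ (L + u) ^ k := pow_le_pow_left₀ hT0 hT k
      _ = L ^ k * (u / L + 1) ^ k := by rw [← mul_pow]; congr 1; field_simp; ring
      _ ≤ L ^ k * exp (u / L) ^ k := by
          gcongr
          exact add_one_le_exp _
      _ = L ^ k * exp (u * (k / L)) := by rw [← exp_nat_mul]; congr 2; ring
  have h3 : (#E : ℝ) * (W * (log x / 2)) ≤ D * x * (L ^ k * exp (u * (k / L)) / k.factorial) := by
    refine h1.trans (hmain.trans ?_)
    gcongr
    exact Nat.floor_le hx0.le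
  calc (#E : ℝ) * W = (#E : ℝ) * (W * (log x / 2)) * (2 / log x) := by field_simp
    _ ≤ D * x * (L ^ k * exp (u * (k / L)) / k.factorial) * (2 / log x) := by gcongr
    _ = _ := by ring

theorem log_log_bounds {x ε : ℝ} (hx : 3 ≤ x) (hε : 1 / log (log x) < ε) (hε2 : ε ≤ 1 / 2) :
    1 < log x ∧ 2 < log (log x) ∧ 0 < ε ∧ 1 ≤ ε * log x := by
  have h1 : 1 < log x := (lt_log_iff_exp_lt (by linarith)).2
    (exp_one_lt_d9.trans_le (by norm_num; linarith))
  have hL : 0 < log (log x) := log_pos h1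
  have h2 : 1 / log (log x) < 1 / 2 := by linarith
  have hε0 : 0 < ε := lt_trans (by positivity) hε
  refine ⟨h1, (one_div_lt_one_div hL two_pos).1 h2, hε0, ?_⟩
  rw [div_lt_iff₀ hL] at hε
  refine hε.le.trans (mul_le_mul_of_nonneg_left ?_ hε0.le)
  linarith [log_le_sub_one_of_pos (show 0 < log x by linarith)]

theorem filter_primesLE_le_rpow {x ε : ℝ} (hx : 3 ≤ x) (hε2 : ε ≤ 1 / 2) :
    (⌊x⌋₊.primesLE).filter (fun p : ℕ => (p : ℝ) ≤ x ^ ε) = (⌊x ^ ε⌋₊).primesLE := by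
  have hx0 : 0 < x := by linarith
  have h : x ^ ε ≤ x := by
    conv_rhs => rw [← rpow_one x]
    exact rpow_le_rpow_of_exponent_le (by linarith) (by linarith)
  ext p
  simp only [Finset.mem_filter, Nat.mem_primesLE]
  rw [Nat.le_floor_iff hx0.le, Nat.le_floor_iff (by positivity)]
  constructor
  · rintro ⟨⟨-, h1⟩, h2⟩
    exact ⟨h2, h1⟩
  · rintro ⟨h1, h2⟩
    exact ⟨⟨h1.trans h, h2⟩, h1⟩

theorem exists_sum_one_or_two_div_le : ∃ C : ℝ, 0 < C ∧ ∀ x ε : ℝ, 3 ≤ x →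
    1 / log (log x) < ε → ε ≤ 1 / 2 →
    ∑ p ∈ ⌊x⌋₊.primesLE, (if (p : ℝ) ≤ x ^ ε then 1 else 2 : ℝ) / p ≤
      log (log x) + (log (1 / ε) + C) := by
  obtain ⟨C, hC, hM⟩ := exists_abs_sum_primes_inv_sub_le
  refine ⟨3 * C, by positivity, fun x ε hx hε hε2 => ?_⟩
  obtain ⟨h1, hL, hε0, hεx⟩ := log_log_bounds hx hε hε2
  have hx0 : 0 < x := by linarith
  have hly : log (x ^ ε) = ε * log x := log_rpow hx0 ε
  have hy : 2 ≤ x ^ ε := by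
    rw [← exp_log (show 0 < x ^ ε by positivity), hly]
    linarith [add_one_le_exp (ε * log x)]
  have h2 : ∑ p ∈ ⌊x⌋₊.primesLE, (if (p : ℝ) ≤ x ^ ε then 1 else 2 : ℝ) / p =
      2 * ∑ p ∈ ⌊x⌋₊.primesLE, 1 / (p : ℝ) - ∑ p ∈ (⌊x ^ ε⌋₊).primesLE, 1 / (p : ℝ) := by
    rw [← filter_primesLE_le_rpow hx hε2, sum_filter, mul_sum, ← sum_sub_distrib]
    refine sum_congr rfl fun p _ => ?_
    split_ifs <;> ring
  rw [h2]
  have h3 := (abs_le.1 (hM x (by linarith))).2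
  have h4 := (abs_le.1 (hM (x ^ ε) hy)).1
  rw [hly, log_mul hε0.ne' (by linarith)] at h4
  rw [one_div ε, log_inv]
  linarith

theorem exists_sum_rpow_div_le : ∃ C : ℝ, 0 < C ∧ ∀ x ε : ℝ, 3 ≤ x →
    1 / log (log x) < ε → ε ≤ 1 / 2 →
    ∑ p ∈ ⌊x⌋₊.primesLE,
      (if (p : ℝ) ≤ x ^ ε then ((p : ℝ) ^ 1) ^ (1 / (ε * log x)) else 1 : ℝ) / p ≤
      log (log x) + C := by
  obtain ⟨C, hC, hM⟩ := exists_abs_sum_primes_inv_sub_le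
  have hl4 : 0 < log 4 := log_pos (by norm_num)
  refine ⟨C + 2 + 2 * log 4, by positivity, fun x ε hx hε hε2 => ?_⟩
  obtain ⟨h1, hL, hε0, hεx⟩ := log_log_bounds hx hε hε2
  have hx0 : 0 < x := by linarith
  have hly : log (x ^ ε) = ε * log x := log_rpow hx0 ε
  set α := 1 / (ε * log x) with hα
  have hα0 : 0 < α := by positivity
  have hα1 : α ≤ 1 := by rw [hα, div_le_one (by linarith)]; exact hεx
  have hy : 1 ≤ x ^ ε := by
    rw [← exp_log (show 0 < x ^ ε by positivity), hly]
    linarith [add_one_le_exp (ε * log x)]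
  have h2 : ∑ p ∈ ⌊x⌋₊.primesLE, (if (p : ℝ) ≤ x ^ ε then ((p : ℝ) ^ 1) ^ α else 1 : ℝ) / p ≤
      ∑ p ∈ ⌊x⌋₊.primesLE, 1 / (p : ℝ) + 2 * α * ∑ p ∈ (⌊x ^ ε⌋₊).primesLE, log p / (p : ℝ) := by
    rw [← filter_primesLE_le_rpow hx hε2, sum_filter, mul_sum, ← sum_add_distrib]
    refine sum_le_sum fun p hp => ?_
    have hp0 : (0 : ℝ) < p := by exact_mod_cast (Nat.mem_primesLE.1 hp).2.pos
    split_ifs with h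
    · have h3 : log p ≤ ε * log x := hly ▸ log_le_log hp0 h
      have h4 : 0 ≤ log (p : ℝ) := log_natCast_nonneg p
      have h5 : log p * α ≤ 1 := by
        rw [hα, mul_one_div, div_le_one (by linarith)]; exact h3
      have h6 : 0 ≤ log p * α := by positivity
      have h7 := abs_exp_sub_one_le (x := log p * α) (by rwa [abs_of_nonneg h6])
      rw [abs_of_nonneg h6] at h7
      have h8 := (abs_le.1 h7).2
      rw [pow_one, rpow_def_of_pos hp0]
      calc exp (log p * α) / p ≤ (1 + 2 * (log p * α)) / p := by gcongr; linarith
        _ = _ := by ring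
    · simp
  refine h2.trans ?_
  have h3 := (abs_le.1 (hM x (by linarith))).2
  have h4 := sum_primes_log_div_le ⌊x ^ ε⌋₊ (Nat.floor_pos.2 hy)
  have h5 : log (⌊x ^ ε⌋₊ : ℝ) ≤ ε * log x := by
    rw [← hly]
    refine log_le_log ?_ (Nat.floor_le (by positivity))
    exact_mod_cast Nat.floor_pos.2 hy
  have h6 : 2 * α * ∑ p ∈ (⌊x ^ ε⌋₊).primesLE, log p / (p : ℝ) ≤
      2 * α * (ε * log x + log 4) := by gcongr; linarith
  have h7 : 2 * α * (ε * log x + log 4) = 2 + 2 * α * log 4 := by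
    rw [hα]; field_simp
  have h8 : α * log 4 ≤ log 4 := mul_le_of_le_one_left hl4.le hα1
  linarith

theorem primeFactors_smoothPart (y : ℝ) (n : ℕ) :
    (smoothPart y n).primeFactors = n.primeFactors.filter (fun p : ℕ => (p : ℝ) ≤ y) := by
  have h0 : smoothPart y n ≠ 0 := prod_ne_zero_iff.2 fun p hp =>
    pow_ne_zero _ (Nat.prime_of_mem_primeFactors (Finset.mem_filter.1 hp).1).ne_zero
  ext q
  rw [Nat.mem_primeFactors_of_ne_zero h0]
  constructor
  · rintro ⟨hq, hd⟩
    obtain ⟨p, hp, hd⟩ := (hq.prime.dvd_finsetProd_iff _).1 hd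
    have hpp := Nat.prime_of_mem_primeFactors (Finset.mem_filter.1 hp).1
    rwa [(Nat.prime_dvd_prime_iff_eq hq hpp).1 (hq.dvd_of_dvd_pow hd)]
  · intro hq
    have hq' := Nat.mem_primeFactors.1 (Finset.mem_filter.1 hq).1
    refine ⟨hq'.1, dvd_trans (dvd_pow_self q ?_)
      (dvd_prod_of_mem (fun p => p ^ n.factorization p) hq)⟩
    exact (hq'.1.factorization_pos_of_dvd hq'.2.2 hq'.2.1).ne'

theorem factorization_prod_one_or_two (y : ℝ) (n : ℕ) :
    n.factorization.prod (fun p _ => if (p : ℝ) ≤ y then 1 else 2 : ℕ → ℕ → ℝ) =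
      2 ^ ((n.primeFactors.card : ℝ) - ((smoothPart y n).primeFactors.card : ℝ)) := by
  have h := card_filter_add_card_filter_not (s := n.primeFactors) (fun p : ℕ => (p : ℝ) ≤ y)
  rw [primeFactors_smoothPart, ← h]
  push_cast
  rw [add_sub_cancel_left, rpow_natCast, Finsupp.prod, Nat.support_factorization, prod_ite]
  simp

theorem factorization_prod_rpow (y α : ℝ) (n : ℕ) :
    n.factorization.prod
      (fun p a => if (p : ℝ) ≤ y then ((p : ℝ) ^ a) ^ α else 1 : ℕ → ℕ → ℝ) =
      (smoothPart y n : ℝ) ^ α := by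
  rw [Finsupp.prod, Nat.support_factorization, smoothPart, prod_ite, prod_const_one, mul_one]
  push_cast
  exact finsetProd_rpow _ _ (fun p _ => by positivity) α

theorem one_lt_log_four_lt_two : 1 < log 4 ∧ log 4 < 2 := by
  have h : log 4 = 2 * log 2 := by
    rw [show (4 : ℝ) = 2 ^ 2 by norm_num, log_pow]; norm_num
  constructor <;> linarith [log_two_gt_d9, log_two_lt_d9]

theorem exists_card_few_small_primes_le (R : ℝ) :
    ∃ C : ℝ, 0 < C ∧ ∀ (x ε : ℝ) (k : ℕ), 3 ≤ x → 1 / log (log x) < ε → ε ≤ 1 / 2 →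
      ((k + 1 : ℕ) : ℝ) ≤ R * log (log x) →
      (#{n ∈ natsWithOmega (k + 1) ⌊x⌋₊ | √x < (n : ℕ) ∧
          ((smoothPart (x ^ ε) n).primeFactors.card : ℝ) ≤
            ((k + 1 : ℕ) : ℝ) - 2 * (((k + 1 : ℕ) : ℝ) / log (log x)) * log (1 / ε)} : ℝ) ≤
        C * ε ^ (((k + 1 : ℕ) : ℝ) / log (log x) * (log 4 - 1)) *
          (x / log x * (log (log x) ^ k / k.factorial)) := by
  obtain ⟨D, K, hD, hK, hDK⟩ := exists_primePower_weight_bounds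
  obtain ⟨C, hC, hM⟩ := exists_sum_one_or_two_div_le
  refine ⟨2 * D * exp ((C + K) * R), by positivity, fun x ε k hx hε hε2 hk => ?_⟩
  obtain ⟨h1, hL, hε0, hεx⟩ := log_log_bounds hx hε hε2
  set L := log (log x)
  set r := ((k + 1 : ℕ) : ℝ) / L with hr
  set g : ℕ → ℕ → ℝ := fun p _ => if (p : ℝ) ≤ x ^ ε then 1 else 2 with hg
  have hg0 : ∀ p a, 0 ≤ g p a := fun p a => by simp only [hg]; split_ifs <;> norm_num
  have hg2 : ∀ p a, g p a ≤ 2 := fun p a => by simp only [hg]; split_ifs <;> norm_num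
  obtain ⟨hD', hT⟩ := hDK g hg0 (fun p _ => (hg2 p 1).trans (by norm_num)) (fun p a hp _ => by
    have h2 : (1 : ℝ) ≤ ((p : ℝ) ^ a) ^ (1 / 8 : ℝ) :=
      one_le_rpow (one_le_pow₀ (by exact_mod_cast hp.one_le)) (by norm_num)
    linarith [hg2 p a])
  have hd : 0 ≤ log (1 / ε) := log_nonneg (by rw [le_div_iff₀ hε0]; linarith)
  have hx0 : 0 < x := by linarith
  have hL0 : 0 < L := by linarith
  have hrR : r ≤ R := by rw [hr, div_le_iff₀ hL0]; exact hk
  have hr0 : 0 ≤ r := by positivity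
  have hkr : (k : ℝ) / L ≤ r := by
    rw [hr]; gcongr; linarith
  have hmain := card_mul_le_of_le_factorization_prod (k := k) (W := 2 ^ (2 * r * log (1 / ε)))
    (u := log (1 / ε) + C + K)
    (E := {n ∈ natsWithOmega (k + 1) ⌊x⌋₊ | √x < (n : ℕ) ∧
          ((smoothPart (x ^ ε) n).primeFactors.card : ℝ) ≤
            ((k + 1 : ℕ) : ℝ) - 2 * r * log (1 / ε)}) hg0 hx hD.le
    (by positivity) (by positivity) hD' (by
      have := hM x ε hx hε hε2
      have h3 := hT ⌊x⌋₊
      simp only [hg] at h3 ⊢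
      linarith) hL0 (fun n hn => by
      rw [Finset.mem_filter] at hn
      refine ⟨hn.1, hn.2.1, ?_⟩
      rw [hg, factorization_prod_one_or_two, (mem_natsWithOmega.1 hn.1).2]
      exact rpow_le_rpow_of_exponent_le (by norm_num) (by linarith [hn.2.2]))
  set A := x / log x * (L ^ k / k.factorial)
  have hA : 0 ≤ A := by positivity
  have h5 : exp ((log (1 / ε) + C + K) * (k / L)) ≤ exp (r * log (1 / ε) + (C + K) * R) := by
    rw [exp_le_exp]
    calc _ ≤ (log (1 / ε) + C + K) * r := by gcongr
      _ = r * log (1 / ε) + (C + K) * r := by ring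
      _ ≤ _ := by gcongr
  have h6 : exp (r * log (1 / ε)) =
      ε ^ (r * (log 4 - 1)) * (2 : ℝ) ^ (2 * r * log (1 / ε)) := by
    rw [rpow_def_of_pos hε0, rpow_def_of_pos two_pos, ← exp_add, one_div, log_inv,
      show (4 : ℝ) = 2 ^ 2 by norm_num, log_pow]
    congr 1
    push_cast
    ring
  refine le_of_mul_le_mul_right (hmain.trans ?_)
    (show (0 : ℝ) < 2 ^ (2 * r * log (1 / ε)) by positivity)
  calc _ ≤ 2 * D * A * exp (r * log (1 / ε) + (C + K) * R) := by gcongr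
    _ = _ := by rw [exp_add, h6]; ring

theorem exists_exp_neg_one_div_sqrt_le (R : ℝ) : ∃ C : ℝ, 0 < C ∧ ∀ ε : ℝ, 0 < ε → ε ≤ 1 →
    ∀ ρ ≤ R, exp (-(1 / √ε)) ≤ C * ε ^ ρ := by
  refine ⟨(2 * ⌈R⌉₊).factorial, by positivity, fun ε hε hε1 ρ hρ => ?_⟩
  set M := ⌈R⌉₊
  have h := pow_div_factorial_le_exp (1 / √ε) (by positivity) (2 * M)
  have h2 : (1 / √ε) ^ (2 * M) = (ε ^ M)⁻¹ := by
    rw [pow_mul, div_pow, sq_sqrt hε.le]; simp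
  have h3 : ε ^ M ≤ ε ^ ρ := by
    rw [← rpow_natCast]
    exact rpow_le_rpow_of_exponent_ge hε hε1 (hρ.trans (Nat.le_ceil R))
  rw [h2] at h
  rw [exp_neg]
  calc (exp (1 / √ε))⁻¹ ≤ ((ε ^ M)⁻¹ / (2 * M).factorial)⁻¹ := inv_anti₀ (by positivity) h
    _ = (2 * M).factorial * ε ^ M := by rw [inv_div, div_inv_eq_mul]
    _ ≤ _ := by gcongr

theorem exists_card_large_smoothPart_le {R : ℝ} (hR : 0 < R) :
    ∃ C : ℝ, 0 < C ∧ ∀ᶠ x : ℝ in atTop, ∀ (ε : ℝ) (k : ℕ), 1 / log (log x) < ε → ε ≤ 1 / 2 →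
      ((k + 1 : ℕ) : ℝ) ≤ R * log (log x) →
      (#{n ∈ natsWithOmega (k + 1) ⌊x⌋₊ | √x < (n : ℕ) ∧
          x ^ √ε < (smoothPart (x ^ ε) n : ℝ)} : ℝ) ≤
        C * ε ^ (((k + 1 : ℕ) : ℝ) / log (log x) * (log 4 - 1)) *
          (x / log x * (log (log x) ^ k / k.factorial)) := by
  obtain ⟨D, K, hD, hK, hDK⟩ := exists_primePower_weight_bounds
  obtain ⟨C, hC, hM⟩ := exists_sum_rpow_div_le
  obtain ⟨B, hB, hexp⟩ := exists_exp_neg_one_div_sqrt_le R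
  refine ⟨2 * D * exp ((C + K) * R) * B, by positivity, ?_⟩
  have hlog : ∀ᶠ t : ℝ in atTop, 8 * (t ^ (0 : ℝ) * (log t) ^ (1 : ℝ)) ≤ t ^ (1 : ℝ) :=
    eventually_rpow_mul_log_rpow_le (by norm_num) 8
  filter_upwards [tendsto_log_atTop.eventually hlog, eventually_ge_atTop 3]
    with x hx8 hx ε k hε hε2 hk
  simp only [rpow_zero, one_mul, rpow_one] at hx8
  obtain ⟨h1, hL, hε0, hεx⟩ := log_log_bounds hx hε hε2
  set L := log (log x)
  set r := ((k + 1 : ℕ) : ℝ) / L with hr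
  set α := 1 / (ε * log x) with hα
  have hx0 : 0 < x := by linarith
  have hL0 : 0 < L := by linarith
  have hα0 : 0 < α := by positivity
  have hα8 : α ≤ 1 / 8 := by
    rw [hα]
    apply one_div_le_one_div_of_le (by norm_num)
    rw [div_lt_iff₀ hL0] at hε
    nlinarith
  set g : ℕ → ℕ → ℝ := fun p a => if (p : ℝ) ≤ x ^ ε then ((p : ℝ) ^ a) ^ α else 1 with hg
  have hg0 : ∀ p a, 0 ≤ g p a := fun p a => by simp only [hg]; split_ifs <;> positivity
  have hly : log (x ^ ε) = ε * log x := log_rpow hx0 ε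
  obtain ⟨hD', hT⟩ := hDK g hg0 (fun p hp => by
    have hp0 : (0 : ℝ) < p := by exact_mod_cast hp.pos
    simp only [hg]
    split_ifs with h
    · have h3 : log p ≤ ε * log x := hly ▸ log_le_log hp0 h
      rw [pow_one, rpow_def_of_pos hp0]
      have h5 : log p * α ≤ 1 := by
        rw [hα, mul_one_div, div_le_one (by linarith)]; exact h3
      linarith [exp_le_exp.2 h5, exp_one_lt_d9]
    · norm_num) (fun p a hp _ => by
    have h3 : (1 : ℝ) ≤ (p : ℝ) ^ a := one_le_pow₀ (by exact_mod_cast hp.one_le)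
    have h2 : (1 : ℝ) ≤ ((p : ℝ) ^ a) ^ (1 / 8 : ℝ) := one_le_rpow h3 (by norm_num)
    simp only [hg]
    split_ifs with h
    · linarith [rpow_le_rpow_of_exponent_le h3 hα8]
    · linarith)
  have hrR : r ≤ R := by rw [hr, div_le_iff₀ hL0]; exact hk
  have hr0 : 0 ≤ r := by positivity
  have hkR : (k : ℝ) / L ≤ R := by
    refine le_trans ?_ hrR
    rw [hr]; gcongr; linarith
  have hmain := card_mul_le_of_le_factorization_prod (k := k) (W := exp (1 / √ε))
    (u := C + K)
    (E := {n ∈ natsWithOmega (k + 1) ⌊x⌋₊ | √x < (n : ℕ) ∧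
          x ^ √ε < (smoothPart (x ^ ε) n : ℝ)}) hg0 hx hD.le
    (by positivity) (by positivity) hD' (by
      have := hM x ε hx hε hε2
      have h3 := hT ⌊x⌋₊
      simp only [hg] at h3 ⊢
      linarith) hL0 (fun n hn => by
      rw [Finset.mem_filter] at hn
      refine ⟨hn.1, hn.2.1, ?_⟩
      rw [hg, factorization_prod_rpow]
      refine le_trans (le_of_eq ?_) (rpow_le_rpow (by positivity) hn.2.2.le hα0.le)
      rw [← rpow_mul hx0.le, rpow_def_of_pos hx0, hα]
      congr 1
      have hs : √ε * √ε = ε := mul_self_sqrt hε0.le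
      have hs0 : 0 < √ε := sqrt_pos.2 hε0
      field_simp
      linarith [sq (√ε)])
  set A := x / log x * (L ^ k / k.factorial)
  have hA : 0 ≤ A := by positivity
  have h5 : exp ((C + K) * (k / L)) ≤ exp ((C + K) * R) := by
    rw [exp_le_exp]; gcongr
  have h6 := hexp ε hε0 (by linarith) (r * (log 4 - 1)) (by
    obtain ⟨h7, h8⟩ := one_lt_log_four_lt_two
    nlinarith)
  calc _ = _ * exp (1 / √ε) * exp (-(1 / √ε)) := by
        rw [mul_assoc, ← exp_add, add_neg_cancel, exp_zero, mul_one]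
    _ ≤ (2 * D * A * exp ((C + K) * (k / L))) * exp (-(1 / √ε)) := by gcongr
    _ ≤ (2 * D * A * exp ((C + K) * R)) * (B * ε ^ (r * (log 4 - 1))) := by gcongr
    _ = _ := by ring

theorem eventually_sqrt_le {R : ℝ} (hR : 1 ≤ R) :
    ∀ᶠ x : ℝ in atTop, ∀ (ε : ℝ) (k : ℕ), 1 / log (log x) < ε → ε ≤ 1 / 2 →
      ((k + 1 : ℕ) : ℝ) ≤ R * log (log x) →
      √x ≤ ε ^ (((k + 1 : ℕ) : ℝ) / log (log x) * (log 4 - 1)) *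
          (x / log x * (log (log x) ^ k / k.factorial)) := by
  have hev : ∀ᶠ x : ℝ in atTop,
      1 * (x ^ (1 / 2 : ℝ) * (log x) ^ (R + 1 + log R * R)) ≤ x ^ (1 : ℝ) :=
    eventually_rpow_mul_log_rpow_le (by norm_num) 1
  filter_upwards [hev, eventually_ge_atTop 3] with x hx1 hx ε k hε hε2 hk
  obtain ⟨h1, hL, hε0, hεx⟩ := log_log_bounds hx hε hε2
  rw [one_mul, rpow_one, ← sqrt_eq_rpow] at hx1
  set L := log (log x) with hLdef
  have hx0 : 0 < x := by linarith
  have hL0 : 0 < L := by linarith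
  have hlx : 0 < log x := by linarith
  have hR0 : 0 < R := by linarith
  set r := ((k + 1 : ℕ) : ℝ) / L with hr
  have hrR : r ≤ R := by rw [hr, div_le_iff₀ hL0]; exact hk
  have hr0 : 0 ≤ r := by positivity
  have hkL : (k : ℝ) ≤ R * L := by push_cast at hk; linarith
  have hεR : (log x) ^ (-R) ≤ ε ^ (r * (log 4 - 1)) := by
    have h3 : (log x)⁻¹ ≤ ε := by
      rw [inv_le_iff_one_le_mul₀ hlx]; exact hεx
    calc (log x) ^ (-R) = ((log x)⁻¹) ^ R := by rw [rpow_neg hlx.le, inv_rpow hlx.le]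
      _ ≤ ε ^ R := rpow_le_rpow (by positivity) h3 hR0.le
      _ ≤ _ := rpow_le_rpow_of_exponent_ge hε0 (by linarith) (by
        obtain ⟨h7, h8⟩ := one_lt_log_four_lt_two
        nlinarith)
  have hLk : (log x) ^ (-(log R * R)) ≤ L ^ k / k.factorial := by
    have h3 : (k.factorial : ℝ) ≤ (R * L) ^ k := by
      calc (k.factorial : ℝ) ≤ (k : ℝ) ^ k := by exact_mod_cast Nat.factorial_le_pow k
        _ ≤ _ := by gcongr
    have h4 : R ^ k ≤ (log x) ^ (log R * R) := by
      rw [← rpow_natCast, rpow_def_of_pos hR0, rpow_def_of_pos hlx, exp_le_exp]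
      calc log R * k ≤ log R * (R * L) := by
            gcongr
            exact log_nonneg hR
        _ = _ := by rw [hLdef]; ring
    rw [rpow_neg hlx.le, le_div_iff₀ (by positivity), inv_mul_le_iff₀ (by positivity)]
    calc (k.factorial : ℝ) ≤ R ^ k * L ^ k := by rw [← mul_pow]; exact h3
      _ ≤ _ := by gcongr
  calc √x ≤ x / (log x) ^ (R + 1 + log R * R) := by rwa [le_div_iff₀ (by positivity)]
    _ = (log x) ^ (-R) * (x / log x * (log x) ^ (-(log R * R))) := by
        rw [rpow_add hlx, rpow_add hlx, rpow_one, rpow_neg hlx.le, rpow_neg hlx.le]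
        field_simp
    _ ≤ _ := by gcongr

/-- The exceptional set, split according to the failing condition. -/
theorem card_exceptional_le {x ε : ℝ} {k : ℕ} {b : ℝ} :
    (#{n ∈ Finset.Icc 1 ⌊x⌋₊ | n.primeFactors.card = k ∧
        ¬(b < ((smoothPart (x ^ ε) n).primeFactors.card : ℝ) ∧
          (smoothPart (x ^ ε) n : ℝ) ≤ x ^ √ε)} : ℝ) ≤
      √x +
      #{n ∈ natsWithOmega k ⌊x⌋₊ | √x < (n : ℕ) ∧
          ((smoothPart (x ^ ε) n).primeFactors.card : ℝ) ≤ b} +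
      #{n ∈ natsWithOmega k ⌊x⌋₊ | √x < (n : ℕ) ∧ x ^ √ε < (smoothPart (x ^ ε) n : ℝ)} := by
  classical
  have h : (#{n ∈ Finset.Icc 1 ⌊x⌋₊ | n.primeFactors.card = k ∧
        ¬(b < ((smoothPart (x ^ ε) n).primeFactors.card : ℝ) ∧
          (smoothPart (x ^ ε) n : ℝ) ≤ x ^ √ε)}) ≤
      #(Finset.Icc 1 ⌊√x⌋₊) +
      #{n ∈ natsWithOmega k ⌊x⌋₊ | √x < (n : ℕ) ∧
          ((smoothPart (x ^ ε) n).primeFactors.card : ℝ) ≤ b} +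
      #{n ∈ natsWithOmega k ⌊x⌋₊ | √x < (n : ℕ) ∧ x ^ √ε < (smoothPart (x ^ ε) n : ℝ)} := by
    refine le_trans (card_le_card fun n hn => ?_) ((card_union_le _ _).trans
      (Nat.add_le_add_right (card_union_le _ _) _))
    simp only [Finset.mem_union, Finset.mem_filter, Finset.mem_Icc, mem_natsWithOmega] at hn ⊢
    obtain ⟨hn1, hnk, hn2⟩ := hn
    by_cases hs : (n : ℝ) ≤ √x
    · exact Or.inl (Or.inl ⟨hn1.1, Nat.le_floor hs⟩)
    · by_cases hb : b < ((smoothPart (x ^ ε) n).primeFactors.card : ℝ)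
      · exact Or.inr ⟨⟨hn1, hnk⟩, not_le.1 hs, not_le.1 fun h => hn2 ⟨hb, h⟩⟩
      · exact Or.inl (Or.inr ⟨⟨hn1, hnk⟩, not_le.1 hs, not_lt.1 hb⟩)
  rw [Nat.card_Icc, Nat.add_sub_cancel] at h
  have h2 := Nat.floor_le (sqrt_nonneg x)
  have h3 : ((#{n ∈ Finset.Icc 1 ⌊x⌋₊ | n.primeFactors.card = k ∧
        ¬(b < ((smoothPart (x ^ ε) n).primeFactors.card : ℝ) ∧
          (smoothPart (x ^ ε) n : ℝ) ≤ x ^ √ε)} : ℕ) : ℝ) ≤ _ := Nat.cast_le.2 h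
  push_cast at h3
  linarith

theorem card_exceptional_le_pik {x : ℝ} {k : ℕ} {P : ℕ → Prop} [DecidablePred P] :
    #{n ∈ Finset.Icc 1 ⌊x⌋₊ | n.primeFactors.card = k ∧ P n} ≤ pik k x := by
  refine card_le_card fun n hn => ?_
  simp only [Finset.mem_filter] at hn ⊢
  exact ⟨hn.1, hn.2.1⟩

end

/-- Uniformly for `x ≥ 3`, `1/log log x < ε ≤ 1/2`, `1 ≤ k ≪ log log x`, `r := k/log log x`,
the conditions `ω(n_ε) > k − 2r log(1/ε)` and `n_ε ≤ x^{√ε}` hold for all but at most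
`O(ε^{r(log 4 − 1)} π_k(x))` of the `n ≤ x` with `ω(n) = k`. -/
theorem stmt_8 (R : ℝ) (hR : 0 < R) :
    ∃ C : ℝ, 0 < C ∧ ∀ (x ε : ℝ) (k : ℕ), 3 ≤ x →
      1 / Real.log (Real.log x) < ε → ε ≤ 1/2 → 1 ≤ k →
      (k : ℝ) ≤ R * Real.log (Real.log x) →
      (((Finset.Icc 1 ⌊x⌋₊).filter
          (fun n => n.primeFactors.card = k ∧
            ¬((k : ℝ) - 2 * ((k : ℝ) / Real.log (Real.log x)) * Real.log (1 / ε)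
                < ((smoothPart (x ^ ε) n).primeFactors.card : ℝ) ∧
              ((smoothPart (x ^ ε) n : ℕ) : ℝ) ≤ x ^ Real.sqrt ε))).card : ℝ)
        ≤ C * ε ^ (((k : ℝ) / Real.log (Real.log x)) * (Real.log 4 - 1))
            * (pik k x : ℝ) := by
  set R' := max R 1
  have hR1 : 1 ≤ R' := le_max_right _ _
  have hR0 : 0 < R' := by linarith
  obtain ⟨c, hc, hlow⟩ := exists_le_pik hR1
  obtain ⟨C₁, hC₁, hE₁⟩ := exists_card_few_small_primes_le R'
  obtain ⟨C₂, hC₂, hE₂⟩ := exists_card_large_smoothPart_le hR0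
  obtain ⟨X, hX⟩ := Filter.eventually_atTop.1 (hlow.and (hE₂.and (eventually_sqrt_le hR1)))
  set Y := max X 3
  have hY : 3 ≤ Y := le_max_right _ _
  have hlY : 0 < log Y := log_pos (by linarith)
  refine ⟨(1 + C₁ + C₂) / c + log Y ^ R', by positivity, fun x ε k hx hε hε2 hk hkR => ?_⟩
  obtain ⟨h1, hL, hε0, hεx⟩ := log_log_bounds hx hε hε2
  set L := log (log x)
  have hL0 : 0 < L := by linarith
  have hkR' : (k : ℝ) ≤ R' * L :=
    hkR.trans (mul_le_mul_of_nonneg_right (le_max_left _ _) hL0.le)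
  set ρ := (k : ℝ) / L * (log 4 - 1) with hρ
  have hρR : ρ ≤ R' := by
    have hr : (k : ℝ) / L ≤ R' := by rw [div_le_iff₀ hL0]; exact hkR'
    have hr0 : 0 ≤ (k : ℝ) / L := by positivity
    obtain ⟨h7, h8⟩ := one_lt_log_four_lt_two
    nlinarith
  have hpik : (0 : ℝ) ≤ pik k x := Nat.cast_nonneg _
  have hερ : 0 < ε ^ ρ := by positivity
  rcases lt_or_ge x Y with hxY | hxY
  · have h2 : 1 ≤ log Y ^ R' * ε ^ ρ := by
      have h3 : 1 ≤ log Y * ε := by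
        have : log x ≤ log Y := log_le_log (by linarith) hxY.le
        nlinarith
      calc 1 ≤ (log Y * ε) ^ R' := one_le_rpow h3 hR0.le
        _ = log Y ^ R' * ε ^ R' := mul_rpow hlY.le hε0.le
        _ ≤ _ := by
          gcongr ?_ * ?_
          exact rpow_le_rpow_of_exponent_ge hε0 (by linarith) hρR
    refine le_trans (Nat.cast_le.2 card_exceptional_le_pik) ?_
    have h4 : 0 ≤ (1 + C₁ + C₂) / c := by positivity
    refine le_mul_of_one_le_left hpik (h2.trans ?_)
    gcongr
    linarith
  · obtain ⟨j, rfl⟩ : ∃ j, k = j + 1 := ⟨k - 1, by omega⟩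
    obtain ⟨hA, hB, hS⟩ := hX x ((le_max_left _ _).trans hxY)
    have hA' := hA j (by push_cast at hkR'; linarith)
    set A := x / log x * (L ^ j / j.factorial)
    have hA2 : A ≤ pik (j + 1) x / c := by
      rw [le_div_iff₀ hc]; linarith
    refine card_exceptional_le.trans ?_
    have hs := hS ε j hε hε2 hkR'
    have he1 := hE₁ x ε j hx hε hε2 hkR'
    have he2 := hB ε j hε hε2 hkR'
    calc _ ≤ ε ^ ρ * A + C₁ * ε ^ ρ * A + C₂ * ε ^ ρ * A := by gcongr
      _ = (1 + C₁ + C₂) * ε ^ ρ * A := by ring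
      _ ≤ (1 + C₁ + C₂) * ε ^ ρ * (pik (j + 1) x / c) := by gcongr
      _ = (1 + C₁ + C₂) / c * ε ^ ρ * pik (j + 1) x := by ring
      _ ≤ _ := by
        gcongr
        linarith [rpow_pos_of_pos hlY R']
end
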